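/- arXiv:2301.08180 — 8 statements merged into one kernel-verified Lean document; each statement's English description precedes it below -/
import Mathlib

section
/- Fix b,p>0 and κ∈ℕ. Then the sequence (1/N)(A_N,S_N,R_N) of rescaled triples (number of attempts, number of successes, number of successful slots) of the slotted-ALOHA interference-based model under the local rule satisfies a large deviation principle with speed N and rate function I_{L,IB}: for every closed set F⊆ℝ³, limsup_{N→∞} (1/N) log P((1/N)(A_N,S_N,R_N)∈F) ≤ −inf_{(a,s,r)∈F} I_{L,IB}(a,s,r), and for every open set G⊆ℝ³, liminf_{N→∞} (1/N) log P((1/N)(A_N,S_N,R_N)∈G) ≥ −inf_{(a,s,r)∈G} I_{L,IB}(a,s,r). -/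
open scoped BigOperators

/-- The Poisson probability mass function with parameter `l`. -/
noncomputable def poissonPMF (l : ℝ) (k : ℕ) : ℝ := Real.exp (-l) * l ^ k / (Nat.factorial k : ℝ)

/-- The binomial probability mass function with parameters `n` and `q`. -/
noncomputable def binPMF (n : ℕ) (q : ℝ) (k : ℕ) : ℝ :=
  (n.choose k : ℝ) * q ^ k * (1 - q) ^ (n - k)

/-- `μ` is a probability mass function. -/
def IsPMF {α : Type*} (μ : α → ℝ) : Prop := (∀ x, 0 ≤ μ x) ∧ HasSum μ 1

-- Relative entropy `H(μ | ν)`, equal to `⊤` if `μ` is not absolutely continuous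
-- with respect to `ν` or if the defining series diverges (to `+∞`).
open Classical in
noncomputable def relEnt {α : Type*} (μ ν : α → ℝ) : EReal :=
  if (∀ x, ν x = 0 → μ x = 0) ∧ Summable (fun x => μ x * Real.log (μ x / ν x))
  then ((∑' x, μ x * Real.log (μ x / ν x) : ℝ) : EReal) else ⊤

/-- The rate function `I_{L,IB}` of the local-rule interference-based model:
`I(a,s,r) = inf { H(μ | Poi_{bp}) : Σ k μ(k) = a, Σ_{k ≤ κ} k μ(k) = s, Σ_{k ≤ κ} μ(k) = r }`,
with `inf ∅ = ⊤`. -/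
noncomputable def ILIB (b p : ℝ) (κ : ℕ) (a s r : ℝ) : EReal :=
  sInf { h : EReal | ∃ μ : ℕ → ℝ, IsPMF μ ∧
      HasSum (fun k : ℕ => (k : ℝ) * μ k) a ∧
      (∑ k ∈ Finset.range (κ + 1), (k : ℝ) * μ k) = s ∧
      (∑ k ∈ Finset.range (κ + 1), μ k) = r ∧
      h = relEnt μ (poissonPMF (b * p)) }

/-- Extended-real-valued logarithm: `elog x = log x` for `x > 0` and `⊥` for `x ≤ 0`. -/
noncomputable def elog (x : ℝ) : EReal := if x ≤ 0 then ⊥ else ((Real.log x : ℝ) : EReal)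

-- `P((1/N)(A_N, S_N, R_N) ∈ E)` in the interference-based model under the local rule.
open Classical in
/- `P((1/N)(A_N, S_N, R_N) ∈ E)` in the interference-based model under the local rule:
the `N` per-slot attempt numbers are i.i.d. `Binomial(⌊bN⌋, p/N)`, and
`A_N, S_N, R_N` are the total numbers of attempts, of successes and of successful slots. -/
noncomputable def probLIB (b p : ℝ) (κ N : ℕ) (E : Set (ℝ × ℝ × ℝ)) : ℝ :=
  ∑' x : Fin N → ℕ,
    if ((((∑ j, x j : ℕ) : ℝ) / (N : ℝ),
         ((∑ j, if x j ≤ κ then x j else 0 : ℕ) : ℝ) / (N : ℝ),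
         ((∑ j, if x j ≤ κ then (1 : ℕ) else 0 : ℕ) : ℝ) / (N : ℝ)) ∈ E)
    then ∏ j, binPMF ⌊b * (N : ℝ)⌋₊ (p / (N : ℝ)) (x j) else 0

lemma poissonPMF_pos' {l : ℝ} (hl : 0 < l) (k : ℕ) : 0 < poissonPMF l k := by
  unfold poissonPMF; positivity

lemma desc_bound (n m : ℕ) (q : ℝ) (hq0 : 0 ≤ q) (hq1 : q ≤ 1) (hm : (n:ℝ) * q ≤ m) (k : ℕ) :
    (n.descFactorial k : ℝ) * (1 - q) ^ m ≤ (n:ℝ) ^ k * (1 - q) ^ k := by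
  have h0 : 0 ≤ 1 - q := by linarith
  have h1 : 1 - q ≤ 1 := by linarith
  induction k with
  | zero => simpa using pow_le_one₀ h0 h1
  | succ k ih =>
    by_cases hk : k + 1 ≤ m
    · have := pow_le_pow_of_le_one h0 h1 hk
      have h2 : (n.descFactorial (k+1) : ℝ) ≤ (n:ℝ)^(k+1) := by
        exact_mod_cast Nat.descFactorial_le_pow n (k+1)
      gcongr
    · have hk' : (m:ℝ) ≤ k := by exact_mod_cast (by omega : m ≤ k)
      rw [Nat.descFactorial_succ]
      have h3 : ((n - k : ℕ) : ℝ) ≤ n * (1 - q) := by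
        rcases le_total k n with h | h
        · rw [Nat.cast_sub h]; nlinarith
        · rw [Nat.sub_eq_zero_of_le h]; simp; positivity
      push_cast
      calc ((n - k : ℕ) : ℝ) * (n.descFactorial k) * (1-q)^m
          = ((n - k : ℕ) : ℝ) * ((n.descFactorial k) * (1-q)^m) := by ring
        _ ≤ (n * (1 - q)) * ((n:ℝ) ^ k * (1 - q) ^ k) := by gcongr
        _ = _ := by ring

lemma binPMF_eq_desc (n k : ℕ) (q : ℝ) :
    binPMF n q k = (n.descFactorial k : ℝ) / (k.factorial : ℝ) * q ^ k * (1 - q) ^ (n - k) := by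
  unfold binPMF
  rw [Nat.descFactorial_eq_factorial_mul_choose]
  have : (k.factorial : ℝ) ≠ 0 := by positivity
  push_cast
  field_simp

lemma binPMF_eq_zero (n k : ℕ) (q : ℝ) (h : n < k) : binPMF n q k = 0 := by
  simp [binPMF, Nat.choose_eq_zero_of_lt h]

lemma binPMF_nonneg (n k : ℕ) (q : ℝ) (hq0 : 0 ≤ q) (hq1 : q ≤ 1) : 0 ≤ binPMF n q k := by
  unfold binPMF
  have : 0 ≤ 1 - q := by linarith
  positivity

lemma binPMF_le (n m : ℕ) (q l : ℝ) (hq0 : 0 ≤ q) (hq1 : q ≤ 1) (hm : l ≤ m)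
    (hl : (n:ℝ) * q ≤ l) (k : ℕ) :
    binPMF n q k * (1 - q) ^ m ≤ poissonPMF l k * Real.exp (l - n * q) := by
  have h0 : 0 ≤ 1 - q := by linarith
  have hnq : 0 ≤ (n:ℝ) * q := by positivity
  have hl0 : 0 ≤ l := by linarith
  by_cases hk : k ≤ n
  · rw [binPMF_eq_desc]
    have h1 := desc_bound n m q hq0 hq1 (by linarith) k
    have h2 : (1 - q) ^ n ≤ Real.exp (-(n * q)) := by
      have := Real.one_sub_le_exp_neg q
      calc (1-q)^n ≤ (Real.exp (-q))^n := by gcongr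
        _ = _ := by rw [← Real.exp_nat_mul]; ring_nf
    calc (n.descFactorial k : ℝ) / (k.factorial : ℝ) * q ^ k * (1 - q) ^ (n - k) * (1-q)^m
        = ((n.descFactorial k : ℝ) * (1-q)^m) * (q ^ k * (1 - q) ^ (n - k) / (k.factorial : ℝ)) := by
          ring
      _ ≤ ((n:ℝ) ^ k * (1 - q) ^ k) * (q ^ k * (1 - q) ^ (n - k) / (k.factorial : ℝ)) := by gcongr
      _ = (n * q)^k * ((1-q)^k * (1-q)^(n-k)) / (k.factorial : ℝ) := by rw [mul_pow]; ring
      _ = (n * q)^k * (1-q)^n / (k.factorial : ℝ) := by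
          rw [← pow_add, Nat.add_sub_cancel' hk]
      _ ≤ l^k * Real.exp (-(n * q)) / (k.factorial : ℝ) := by gcongr
      _ = _ := by
          unfold poissonPMF
          rw [show -((n:ℝ) * q) = -l + (l - n * q) by ring, Real.exp_add]; ring
  · rw [binPMF_eq_zero _ _ _ (by omega)]
    unfold poissonPMF; simp; positivity

lemma ent_bound (b p : ℝ) (hb : 0 < b) (hp : 0 < p) (κ N : ℕ) (hN : 0 < N) (A S R : ℕ)
    (E : Finset (Fin N → ℕ))
    (hE : ∀ x ∈ E, (∑ j, x j) = A ∧ (∑ j, if x j ≤ κ then x j else 0) = S ∧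
      (∑ j, if x j ≤ κ then 1 else 0) = R) (c : ℝ)
    (hc : (c : EReal) ≤ ILIB b p κ ((A:ℝ)/N) ((S:ℝ)/N) ((R:ℝ)/N)) :
    ∑ x ∈ E, ∏ j, poissonPMF (b * p) (x j) ≤ Real.exp (-(N * c)) := by
  classical
  have hl : 0 < b * p := by positivity
  set ν := poissonPMF (b * p) with hν
  have hνp : ∀ k, 0 < ν k := poissonPMF_pos' hl
  rcases E.eq_empty_or_nonempty with rfl | hne
  · simp; positivity
  have hNR : (0:ℝ) < N := by exact_mod_cast hN
  set Z := ∑ x ∈ E, ∏ j, ν (x j) with hZ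
  have hPp : ∀ x : Fin N → ℕ, 0 < ∏ j, ν (x j) := fun x => Finset.prod_pos fun j _ => hνp _
  have hZp : 0 < Z := Finset.sum_pos (fun x _ => hPp x) hne
  set Q : (Fin N → ℕ) → ℝ := fun x => (∏ j, ν (x j)) / Z with hQ
  have hQp : ∀ x, 0 < Q x := fun x => div_pos (hPp x) hZp
  have hQ1 : ∑ x ∈ E, Q x = 1 := by
    simp only [hQ]; rw [← Finset.sum_div]; exact div_self hZp.ne'
  set μ : ℕ → ℝ := fun k => ∑ x ∈ E, Q x * (∑ j, if x j = k then (1:ℝ) else 0) / N with hμ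
  have key : ∀ (K : Finset ℕ) (f : ℕ → ℝ), ∑ k ∈ K, f k * μ k =
      ∑ x ∈ E, Q x * (∑ j, if x j ∈ K then f (x j) else 0) / N := by
    intro K f
    simp only [hμ, Finset.mul_sum]
    rw [Finset.sum_comm]
    refine Finset.sum_congr rfl fun x _ => ?_
    have : ∀ j, (if x j ∈ K then f (x j) else 0) = ∑ k ∈ K, f k * (if x j = k then (1:ℝ) else 0) := by
      intro j; simp
    simp only [this, Finset.mul_sum, Finset.sum_div]
    rw [Finset.sum_comm]
    refine Finset.sum_congr rfl fun j _ => Finset.sum_congr rfl fun k _ => ?_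
    ring
  have hxA : ∀ x ∈ E, ∀ j, x j < A + 1 := by
    intro x hx j
    have := (hE x hx).1
    have h2 := Finset.single_le_sum (f := x) (fun i _ => Nat.zero_le _) (Finset.mem_univ j)
    omega
  have hμ0 : ∀ k, 0 ≤ μ k := fun k => Finset.sum_nonneg fun x _ => by
    have := (hQp x).le
    have h2 : 0 ≤ ∑ j, if x j = k then (1:ℝ) else 0 := Finset.sum_nonneg fun j _ => by positivity
    positivity
  have hμz : ∀ k ∉ Finset.range (A+1), μ k = 0 := by
    intro k hk
    refine Finset.sum_eq_zero fun x hx => ?_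
    have : ∀ j, (if x j = k then (1:ℝ) else 0) = 0 := by
      intro j
      rw [if_neg]; rintro rfl
      exact hk (Finset.mem_range.2 (hxA x hx j))
    simp [this]
  have keyA : ∀ f : ℕ → ℝ, ∑ k ∈ Finset.range (A+1), f k * μ k =
      ∑ x ∈ E, Q x * (∑ j, f (x j)) / N := by
    intro f
    rw [key]
    refine Finset.sum_congr rfl fun x hx => ?_
    congr 2
    refine Finset.sum_congr rfl fun j _ => ?_
    rw [if_pos (Finset.mem_range.2 (hxA x hx j))]
  have hμ1 : ∑ k ∈ Finset.range (A+1), μ k = 1 := by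
    have := keyA (fun _ => 1)
    simp only [one_mul] at this
    rw [this]
    refine Eq.trans (Finset.sum_congr rfl fun x hx => ?_) hQ1
    simp; field_simp
  have hpmf : IsPMF μ := ⟨hμ0, by
    rw [← hμ1]; exact hasSum_sum_of_ne_finset_zero hμz⟩
  have hmean : HasSum (fun k : ℕ => (k:ℝ) * μ k) ((A:ℝ)/N) := by
    have : ∑ k ∈ Finset.range (A+1), (k:ℝ) * μ k = (A:ℝ)/N := by
      rw [keyA (fun k => (k:ℝ))]
      rw [← one_mul ((A:ℝ)/N), ← hQ1, Finset.sum_mul]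
      refine Finset.sum_congr rfl fun x hx => ?_
      rw [← (hE x hx).1]; push_cast; ring
    rw [← this]
    exact hasSum_sum_of_ne_finset_zero fun k hk => by rw [hμz k hk, mul_zero]
  have hS : (∑ k ∈ Finset.range (κ + 1), (k : ℝ) * μ k) = (S:ℝ)/N := by
    rw [key _ (fun k => (k:ℝ))]
    rw [← one_mul ((S:ℝ)/N), ← hQ1, Finset.sum_mul]
    refine Finset.sum_congr rfl fun x hx => ?_
    rw [← (hE x hx).2.1]; push_cast; simp only [Finset.mem_range, Nat.lt_succ_iff]
    ring
  have hR : (∑ k ∈ Finset.range (κ + 1), μ k) = (R:ℝ)/N := by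
    have := key (Finset.range (κ+1)) (fun k => (1:ℝ))
    simp only [one_mul] at this
    rw [this]
    have e : ∑ x ∈ E, Q x * ((R:ℝ)/N) = (R:ℝ)/N := by rw [← Finset.sum_mul, hQ1, one_mul]
    rw [← e]
    refine Finset.sum_congr rfl fun x hx => ?_
    rw [← (hE x hx).2.2]; push_cast; simp only [Finset.mem_range, Nat.lt_succ_iff]
    ring
  have hrel : relEnt μ ν = ((∑ k ∈ Finset.range (A+1), μ k * Real.log (μ k / ν k) : ℝ) : EReal) := by
    have hz : ∀ k ∉ Finset.range (A+1), μ k * Real.log (μ k / ν k) = 0 := fun k hk => by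
      rw [hμz k hk, zero_mul]
    unfold relEnt
    rw [if_pos ⟨fun k hk => absurd hk (hνp k).ne', summable_of_ne_finset_zero (s := Finset.range (A+1)) hz⟩]
    rw [tsum_eq_sum hz]
  have hle : (c : EReal) ≤ relEnt μ ν :=
    hc.trans (sInf_le ⟨μ, hpmf, hmean, hS, hR, rfl⟩)
  rw [hrel, EReal.coe_le_coe_iff] at hle
  -- Gibbs
  have hμx : ∀ x ∈ E, ∀ j, 0 < μ (x j) := by
    intro x hx j
    refine Finset.sum_pos' (fun y _ => ?_) ⟨x, hx, ?_⟩
    · have := (hQp y).le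
      have h2 : 0 ≤ ∑ i, if y i = x j then (1:ℝ) else 0 := Finset.sum_nonneg fun j _ => by positivity
      positivity
    · have h2 : 0 < ∑ i, if x i = x j then (1:ℝ) else 0 :=
        Finset.sum_pos' (fun i _ => by positivity) ⟨j, Finset.mem_univ j, by simp⟩
      have := hQp x
      positivity
  have hRsum : ∑ x ∈ E, ∏ j, μ (x j) ≤ 1 := by
    calc ∑ x ∈ E, ∏ j, μ (x j) ≤ ∑ x ∈ Fintype.piFinset (fun _ : Fin N => Finset.range (A+1)), ∏ j, μ (x j) := by
          refine Finset.sum_le_sum_of_subset_of_nonneg ?_ fun x _ _ => Finset.prod_nonneg fun j _ => hμ0 _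
          intro x hx
          rw [Fintype.mem_piFinset]
          exact fun j => Finset.mem_range.2 (hxA x hx j)
      _ = ∏ j : Fin N, ∑ k ∈ Finset.range (A+1), μ k := (Finset.prod_univ_sum _ _).symm
      _ = 1 := by simp [hμ1]
  have gibbs : ∑ x ∈ E, Q x * (∑ j, (Real.log (μ (x j) / ν (x j)))) + Real.log Z ≤ 0 := by
    have : ∀ x ∈ E, Q x * (∑ j, (Real.log (μ (x j) / ν (x j)))) + Q x * Real.log Z ≤
        ∏ j, μ (x j) - Q x := by
      intro x hx
      have hm : 0 < ∏ j, μ (x j) := Finset.prod_pos fun j _ => hμx x hx j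
      rw [← Real.log_prod (fun j _ => (div_pos (hμx x hx j) (hνp _)).ne'), Finset.prod_div_distrib,
        ← mul_add, ← Real.log_mul (div_pos hm (hPp x)).ne' hZp.ne']
      have h1 : (∏ j, μ (x j)) / (∏ j, ν (x j)) * Z = (∏ j, μ (x j)) / Q x := by
        simp only [hQ]; have := hPp x; field_simp
      rw [h1]
      have h2 := Real.log_le_sub_one_of_pos (div_pos hm (hQp x))
      calc Q x * Real.log ((∏ j, μ (x j)) / Q x) ≤ Q x * ((∏ j, μ (x j)) / Q x - 1) :=
            mul_le_mul_of_nonneg_left h2 (hQp x).le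
        _ = _ := by have := (hQp x).ne'; field_simp
    have h3 := Finset.sum_le_sum this
    rw [Finset.sum_add_distrib, ← Finset.sum_mul, hQ1, one_mul, Finset.sum_sub_distrib, hQ1] at h3
    linarith
  have hk2 := keyA (fun k => Real.log (μ k / ν k))
  rw [← Finset.sum_div] at hk2
  have hk3 : ∑ k ∈ Finset.range (A+1), μ k * Real.log (μ k / ν k) = ∑ k ∈ Finset.range (A+1), Real.log (μ k / ν k) * μ k :=
    Finset.sum_congr rfl fun k _ => mul_comm _ _
  rw [hk3, hk2, le_div_iff₀ hNR] at hle
  rw [← Real.log_le_iff_le_exp hZp]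
  linarith

/-- The rescaled triple. -/
noncomputable def trip (κ N : ℕ) (x : Fin N → ℕ) : ℝ × ℝ × ℝ :=
  (((∑ j, x j : ℕ) : ℝ) / (N : ℝ),
         ((∑ j, if x j ≤ κ then x j else 0 : ℕ) : ℝ) / (N : ℝ),
         ((∑ j, if x j ≤ κ then (1 : ℕ) else 0 : ℕ) : ℝ) / (N : ℝ))

open Classical in
lemma probLIB_eq (b p : ℝ) (κ N : ℕ) (E : Set (ℝ × ℝ × ℝ)) :
    probLIB b p κ N E =
      ∑ x ∈ (Fintype.piFinset (fun _ : Fin N => Finset.range (⌊b * (N:ℝ)⌋₊ + 1))).filter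
        (fun x => trip κ N x ∈ E), ∏ j, binPMF ⌊b * (N : ℝ)⌋₊ (p / (N : ℝ)) (x j) := by
  unfold probLIB
  rw [Finset.sum_filter]
  rw [tsum_eq_sum (s := Fintype.piFinset (fun _ : Fin N => Finset.range (⌊b * (N:ℝ)⌋₊ + 1)))]
  · rfl
  · intro x hx
    rw [Fintype.mem_piFinset] at hx
    push Not at hx
    obtain ⟨j, hj⟩ := hx
    rw [Finset.mem_range, not_lt] at hj
    split_ifs
    · exact Finset.prod_eq_zero (Finset.mem_univ j) (binPMF_eq_zero _ _ _ (by omega))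
    · rfl

lemma prod_bin_le (b p : ℝ) (hb : 0 < b) (hp : 0 < p) (N : ℕ) (hN : 0 < N) (hN2 : 2 * p ≤ N)
    (x : Fin N → ℕ) :
    ∏ j, binPMF ⌊b * (N : ℝ)⌋₊ (p / (N : ℝ)) (x j) ≤
      Real.exp (p + 2 * p * ⌈b * p⌉₊) * ∏ j, poissonPMF (b * p) (x j) := by
  have hNR : (0:ℝ) < N := by exact_mod_cast hN
  set q := p / (N:ℝ) with hq
  set n := ⌊b * (N : ℝ)⌋₊ with hn
  set m := ⌈b * p⌉₊ with hm
  have hq0 : 0 < q := by positivity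
  have hNq : N * q = p := by rw [hq]; field_simp
  have hq1 : q ≤ 1 / 2 := by rw [hq, div_le_iff₀ hNR]; linarith
  have hn1 : (n:ℝ) ≤ b * N := Nat.floor_le (by positivity)
  have hn2 : b * N < n + 1 := Nat.lt_floor_add_one _
  have hl : (n:ℝ) * q ≤ b * p := by
    calc (n:ℝ) * q ≤ b * N * q := by gcongr
      _ = b * p := by rw [mul_assoc, hNq]
  have hl2 : N * (b * p - n * q) ≤ p := by
    have : N * (b * p - n * q) = (b * N - n) * p := by
      linear_combination (-(n:ℝ)) * hNq
    rw [this]; nlinarith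
  have hexp : Real.exp (-(2 * q)) ≤ 1 - q := by
    have h1 := Real.add_one_le_exp (2 * q)
    rw [Real.exp_neg, inv_le_comm₀ (Real.exp_pos _) (by linarith)]
    refine le_trans ?_ h1
    rw [inv_le_iff_one_le_mul₀ (by linarith)]; nlinarith
  have h1 : Real.exp (-(2 * p * m)) * ∏ j, binPMF n q (x j) ≤
      Real.exp p * ∏ j, poissonPMF (b * p) (x j) := by
    calc Real.exp (-(2 * p * m)) * ∏ j, binPMF n q (x j)
        = ((Real.exp (-(2*q)))^m)^N * ∏ j, binPMF n q (x j) := by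
          rw [← Real.exp_nat_mul, ← Real.exp_nat_mul]
          congr 2; linear_combination (2 * (m:ℝ)) * hNq
      _ ≤ ((1-q)^m)^N * ∏ j, binPMF n q (x j) := by
          have : 0 ≤ ∏ j, binPMF n q (x j) :=
            Finset.prod_nonneg fun j _ => binPMF_nonneg _ _ _ hq0.le (by linarith)
          gcongr
      _ = ∏ j, (binPMF n q (x j) * (1-q)^m) := by
          rw [Finset.prod_mul_distrib]; simp [mul_comm]
      _ ≤ ∏ j, (poissonPMF (b * p) (x j) * Real.exp (b * p - n * q)) := by
          refine Finset.prod_le_prod (fun j _ => ?_) fun j _ => ?_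
          · exact mul_nonneg (binPMF_nonneg _ _ _ hq0.le (by linarith)) (pow_nonneg (by linarith) _)
          · exact binPMF_le n m q (b * p) hq0.le (by linarith) (Nat.le_ceil _) hl _
      _ = Real.exp (N * (b * p - n * q)) * ∏ j, poissonPMF (b * p) (x j) := by
          rw [Finset.prod_mul_distrib, Real.exp_nat_mul]; simp [mul_comm]
      _ ≤ _ := by
          have : 0 ≤ ∏ j, poissonPMF (b * p) (x j) :=
            Finset.prod_nonneg fun j _ => (poissonPMF_pos' (by positivity) _).le
          gcongr
  have h2 : Real.exp (2 * p * m) * (Real.exp (-(2 * p * m)) * ∏ j, binPMF n q (x j)) =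
      ∏ j, binPMF n q (x j) := by
    rw [← mul_assoc, ← Real.exp_add]; simp
  rw [← h2, add_comm p, Real.exp_add, mul_assoc (Real.exp (2 * p * m)) (Real.exp p)]
  exact mul_le_mul_of_nonneg_left h1 (Real.exp_pos _).le

lemma upper_pt (b p : ℝ) (hb : 0 < b) (hp : 0 < p) (κ N : ℕ) (hN : 0 < N) (hN2 : 2 * p ≤ N)
    (F : Set (ℝ × ℝ × ℝ)) (c : ℝ)
    (hc : (c : EReal) ≤ ⨅ x ∈ F, ILIB b p κ x.1 x.2.1 x.2.2) :
    probLIB b p κ N F ≤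
      (Real.exp (p + 2 * p * ⌈b * p⌉₊) * ((b + 1) ^ 2 * 2)) * (N:ℝ) ^ 5 * Real.exp (-(N * c)) := by
  classical
  have hNR : (1:ℝ) ≤ N := by exact_mod_cast hN
  rw [probLIB_eq]
  set n := ⌊b * (N : ℝ)⌋₊ with hn
  have hn1 : (n:ℝ) ≤ b * N := Nat.floor_le (by positivity)
  set fil := (Fintype.piFinset (fun _ : Fin N => Finset.range (n + 1))).filter
        (fun x => trip κ N x ∈ F) with hfil
  set C := Real.exp (p + 2 * p * ⌈b * p⌉₊) with hC
  set τ : (Fin N → ℕ) → ℕ × ℕ × ℕ := fun x => (∑ j, x j, ∑ j, (if x j ≤ κ then x j else 0),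
    ∑ j, (if x j ≤ κ then 1 else 0)) with hτ
  set TT := Finset.range (n * N + 1) ×ˢ (Finset.range (n * N + 1) ×ˢ Finset.range (N + 1)) with hTT
  have hmaps : ∀ x ∈ fil, τ x ∈ TT := by
    intro x hx
    rw [hfil, Finset.mem_filter, Fintype.mem_piFinset] at hx
    have hx1 : ∀ j, x j ≤ n := fun j => by have := hx.1 j; rw [Finset.mem_range] at this; omega
    have e1 : ∑ j, x j ≤ n * N := by
      refine (Finset.sum_le_sum fun j _ => hx1 j).trans ?_; simp [mul_comm]
    have e2 : ∑ j, (if x j ≤ κ then x j else 0) ≤ n * N := by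
      refine (Finset.sum_le_sum (g := fun _ => n) fun j _ => ?_).trans ?_
      · split_ifs; exacts [hx1 j, Nat.zero_le _]
      · simp [mul_comm]
    have e3 : ∑ j, (if x j ≤ κ then 1 else 0) ≤ N := by
      refine (Finset.sum_le_sum (g := fun _ => 1) fun j _ => ?_).trans ?_
      · split_ifs <;> simp
      · simp
    simp only [hTT, hτ, Finset.mem_product, Finset.mem_range, Nat.lt_succ_iff]
    exact ⟨e1, e2, e3⟩
  have hfib : ∀ T ∈ TT, ∑ x ∈ fil with τ x = T, ∏ j, poissonPMF (b * p) (x j) ≤ Real.exp (-(N * c)) := by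
    intro T _
    rcases (fil.filter (fun x => τ x = T)).eq_empty_or_nonempty with he | ⟨y, hy⟩
    · rw [he]; simp; positivity
    · refine ent_bound b p hb hp κ N hN T.1 T.2.1 T.2.2 _ ?_ c ?_
      · intro x hx
        rw [Finset.mem_filter] at hx
        rw [← hx.2]; exact ⟨rfl, rfl, rfl⟩
      · rw [Finset.mem_filter, hfil, Finset.mem_filter] at hy
        obtain ⟨⟨_, hyF⟩, hyT⟩ := hy
        rw [← hyT]
        exact hc.trans (iInf₂_le (f := fun (x : ℝ × ℝ × ℝ) (_ : x ∈ F) => ILIB b p κ x.1 x.2.1 x.2.2) _ hyF)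
  have hcard : (TT.card : ℝ) ≤ ((b + 1) ^ 2 * 2) * (N:ℝ)^5 := by
    rw [hTT]; simp only [Finset.card_product, Finset.card_range]
    push_cast
    have h1 : (n:ℝ) * N + 1 ≤ (b+1) * N^2 := by nlinarith
    have h2 : (N:ℝ) + 1 ≤ 2 * N := by linarith
    calc ((n:ℝ) * N + 1) * (((n:ℝ) * N + 1) * (N + 1)) ≤ ((b+1) * N^2) * (((b+1) * N^2) * (2 * N)) := by
          gcongr
      _ = _ := by ring
  calc ∑ x ∈ fil, ∏ j, binPMF n (p / (N : ℝ)) (x j)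
      ≤ ∑ x ∈ fil, C * ∏ j, poissonPMF (b * p) (x j) :=
        Finset.sum_le_sum fun x _ => prod_bin_le b p hb hp N hN hN2 x
    _ = C * ∑ T ∈ TT, ∑ x ∈ fil with τ x = T, ∏ j, poissonPMF (b * p) (x j) := by
        rw [← Finset.mul_sum, Finset.sum_fiberwise_of_maps_to hmaps]
    _ ≤ C * ∑ T ∈ TT, Real.exp (-(N * c)) := by
        gcongr with T hT; exact hfib T hT
    _ = C * (TT.card * Real.exp (-(N * c))) := by simp
    _ ≤ C * (((b + 1) ^ 2 * 2) * (N:ℝ)^5 * Real.exp (-(N * c))) := by gcongr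
    _ = _ := by ring

lemma elog_le {N : ℕ} (hN : 0 < N) {x c : ℝ} (h : x ≤ Real.exp (N * c)) :
    (((N : ℝ)⁻¹ : ℝ) : EReal) * elog x ≤ (c : EReal) := by
  have hNR : (0:ℝ) < N := by exact_mod_cast hN
  unfold elog
  split_ifs with hx
  · rw [EReal.coe_mul_bot_of_pos (by positivity)]; exact bot_le
  · rw [← EReal.coe_mul, EReal.coe_le_coe_iff]
    have := (Real.log_le_iff_le_exp (not_le.1 hx)).2 h
    rw [inv_mul_le_iff₀ hNR]; exact this

lemma le_elog {N : ℕ} (hN : 0 < N) {x c : ℝ} (h : Real.exp (N * c) ≤ x) :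
    (c : EReal) ≤ (((N : ℝ)⁻¹ : ℝ) : EReal) * elog x := by
  have hNR : (0:ℝ) < N := by exact_mod_cast hN
  have hx : 0 < x := (Real.exp_pos _).trans_le h
  unfold elog
  rw [if_neg (not_le.2 hx)]
  rw [← EReal.coe_mul, EReal.coe_le_coe_iff]
  have := (Real.le_log_iff_exp_le hx).2 h
  rw [le_inv_mul_iff₀ hNR]; exact this

lemma upper_bound (b p : ℝ) (hb : 0 < b) (hp : 0 < p) (κ : ℕ) (F : Set (ℝ × ℝ × ℝ)) :
    Filter.limsup (fun N : ℕ => (((N : ℝ)⁻¹ : ℝ) : EReal) * elog (probLIB b p κ N F))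
          Filter.atTop
        ≤ -(⨅ x ∈ F, ILIB b p κ x.1 x.2.1 x.2.2) := by
  rw [EReal.le_neg]
  by_contra hcon
  rw [not_le] at hcon
  obtain ⟨c', hc1, hc2⟩ := EReal.lt_iff_exists_real_btwn.1 hcon
  obtain ⟨c, hc3, hc4⟩ := EReal.lt_iff_exists_real_btwn.1 hc1
  rw [EReal.coe_lt_coe_iff] at hc4
  refine absurd hc3 (not_lt.2 ?_)
  rw [EReal.le_neg, ← EReal.coe_neg]
  set K := Real.exp (p + 2 * p * ⌈b * p⌉₊) * ((b + 1) ^ 2 * 2) with hK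
  have hδ : 0 < c' - c := by linarith
  have h1 : Filter.Tendsto (fun N : ℕ => (c' - c) * (N:ℝ)) Filter.atTop Filter.atTop :=
    tendsto_natCast_atTop_atTop.const_mul_atTop hδ
  have h2 := ((Real.tendsto_pow_mul_exp_neg_atTop_nhds_zero 5).comp h1).const_mul (K / (c' - c)^5)
  rw [mul_zero] at h2
  refine Filter.limsup_le_of_le (by isBoundedDefault) ?_
  filter_upwards [h2.eventually (gt_mem_nhds (show (0:ℝ) < 1 by norm_num)),
    Filter.eventually_gt_atTop 0, tendsto_natCast_atTop_atTop.eventually_ge_atTop (2 * p)] with N hN hN0 hN2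
  refine elog_le hN0 ((upper_pt b p hb hp κ N hN0 hN2 F c' hc2.le).trans ?_)
  rw [← hK]
  have e1 : K * (N:ℝ)^5 * Real.exp (-(N * c')) =
      (K / (c' - c)^5 * ((fun x : ℝ => x ^ 5 * Real.exp (-x)) ∘ fun N : ℕ => (c' - c) * (N:ℝ)) N) *
        Real.exp (N * -c) := by
    simp only [Function.comp]
    rw [show -((N:ℝ) * c') = -((c' - c) * N) + N * -c by ring, Real.exp_add, mul_pow]
    field_simp
  rw [e1]
  exact mul_le_of_le_one_left (Real.exp_pos _).le hN.le

lemma bin_lower (b p : ℝ) (hb : 0 < b) (hp : 0 < p) (k : ℕ) (t : ℝ) (ht : t < poissonPMF (b * p) k) :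
    ∀ᶠ N : ℕ in Filter.atTop, t ≤ binPMF ⌊b * (N : ℝ)⌋₊ (p / (N : ℝ)) k := by
  have hinv : Filter.Tendsto (fun N : ℕ => p * ((N:ℝ))⁻¹) Filter.atTop (nhds 0) := by
    simpa using (tendsto_inv_atTop_nhds_zero_nat (𝕜 := ℝ)).const_mul p
  have hbase : Filter.Tendsto (fun N : ℕ => b * p - k * (p * ((N:ℝ))⁻¹)) Filter.atTop (nhds (b * p)) := by
    simpa using (hinv.const_mul (k:ℝ)).const_sub (b * p)
  have hL : Filter.Tendsto (fun N : ℕ => (b * p - k * (p * ((N:ℝ))⁻¹)) ^ k / (k.factorial : ℝ) *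
      Real.exp (-((b * p) / (1 - p * ((N:ℝ))⁻¹)))) Filter.atTop (nhds (poissonPMF (b * p) k)) := by
    have h1 := (hbase.pow k).div_const (k.factorial : ℝ)
    have h2 : Filter.Tendsto (fun N : ℕ => -((b * p) / (1 - p * ((N:ℝ))⁻¹))) Filter.atTop
        (nhds (-(b * p))) := by
      have := ((tendsto_const_nhds (x := b * p)).div (hinv.const_sub 1) (by simp)).neg
      simpa using this
    have h3 := h1.mul ((Real.continuous_exp.tendsto _).comp h2)
    have e : poissonPMF (b * p) k = (b * p) ^ k / (k.factorial : ℝ) * Real.exp (-(b * p)) := by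
      unfold poissonPMF; ring
    rw [e]; exact h3
  filter_upwards [hL.eventually (lt_mem_nhds ht), Filter.eventually_gt_atTop 0,
    hinv.eventually (gt_mem_nhds (show (0:ℝ) < 1 by norm_num)),
    hbase.eventually (lt_mem_nhds (show (0:ℝ) < b * p by positivity))] with N h1 hN hq1 hb0
  refine h1.le.trans ?_
  have hNR : (0:ℝ) < N := by exact_mod_cast hN
  rw [binPMF_eq_desc, ← div_eq_mul_inv] at *
  set q := p / (N:ℝ) with hq
  set n := ⌊b * (N : ℝ)⌋₊ with hn
  have hq0 : 0 < q := by positivity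
  have hNq : N * q = p := by rw [hq]; field_simp
  have hn1 : (n:ℝ) ≤ b * N := Nat.floor_le (by positivity)
  have hn2 : b * N < n + 1 := Nat.lt_floor_add_one _
  have hd : (((n + 1 - k : ℕ) : ℝ)) ^ k ≤ n.descFactorial k := by
    exact_mod_cast Nat.pow_sub_le_descFactorial n k
  have hc : b * N - k ≤ ((n + 1 - k : ℕ) : ℝ) := by
    rcases le_total k (n+1) with h | h
    · rw [Nat.cast_sub h]; push_cast; linarith
    · have : ((n:ℝ)+1) ≤ k := by exact_mod_cast h
      have h2 : (0:ℝ) ≤ ((n + 1 - k : ℕ) : ℝ) := Nat.cast_nonneg _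
      linarith
  have hq' : 0 < 1 - q := by linarith
  have e1 : b * p - k * q = (b * N - k) * q := by rw [← hNq]; ring
  have e2 : (b * p - k * q)^k ≤ n.descFactorial k * q ^ k := by
    calc (b * p - k * q)^k ≤ (((n + 1 - k : ℕ) : ℝ) * q)^k := by
          refine pow_le_pow_left₀ hb0.le ?_ _
          rw [e1]; gcongr
      _ = (((n + 1 - k : ℕ) : ℝ))^k * q^k := mul_pow _ _ _
      _ ≤ _ := by gcongr
  have e3 : Real.exp (-((b * p) / (1 - q))) ≤ (1-q)^(n-k) := by
    have h4 : Real.exp (-(q/(1-q))) ≤ 1 - q := by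
      rw [← Real.le_log_iff_exp_le hq']
      have := Real.one_sub_inv_le_log_of_pos hq'
      refine le_trans (le_of_eq ?_) this
      field_simp; ring
    calc Real.exp (-((b * p) / (1 - q))) ≤ Real.exp (n * (-(q/(1-q)))) := by
          rw [Real.exp_le_exp]
          have : (n:ℝ) * (-(q/(1-q))) = -((n * q)/(1-q)) := by ring
          rw [this, neg_le_neg_iff]
          have h5 : (n:ℝ) * q ≤ b * p := by rw [← hNq]; nlinarith
          exact div_le_div_of_nonneg_right h5 hq'.le
      _ = (Real.exp (-(q/(1-q))))^n := Real.exp_nat_mul _ _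
      _ ≤ (1-q)^n := by gcongr
      _ ≤ (1-q)^(n-k) := pow_le_pow_of_le_one hq'.le (by linarith) (Nat.sub_le _ _)
  calc (b * p - k * q) ^ k / (k.factorial : ℝ) * Real.exp (-((b * p) / (1 - q)))
      ≤ (n.descFactorial k * q ^ k) / (k.factorial : ℝ) * (1-q)^(n-k) := by gcongr
    _ = _ := by ring

lemma chernoff (M : ℕ) (w g : ℕ → ℝ) (hw : ∀ k, 0 ≤ w k) (hw1 : ∑ k ∈ Finset.range M, w k = 1)
    (m : ℝ) (hm : ∑ k ∈ Finset.range M, g k * w k = m) (ε : ℝ) (hε : 0 < ε) :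
    Filter.Tendsto (fun N : ℕ => ∑ x ∈ (Fintype.piFinset (fun _ : Fin N => Finset.range M)) with
      N * (m + ε) ≤ ∑ j, g (x j), ∏ j, w (x j)) Filter.atTop (nhds 0) := by
  classical
  set B := 1 + ∑ k ∈ Finset.range M, |g k - m| with hB
  have hB1 : 1 ≤ B := by
    rw [hB]; linarith [Finset.sum_nonneg (s := Finset.range M) fun k _ => abs_nonneg (g k - m)]
  have hgB : ∀ k ∈ Finset.range M, |g k - m| ≤ B := fun k hk => by
    have := Finset.single_le_sum (f := fun k => |g k - m|) (fun i _ => abs_nonneg _) hk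
    rw [hB]; linarith
  obtain ⟨θ, hθ0, hθB, hθε⟩ : ∃ θ : ℝ, 0 < θ ∧ θ * B ≤ 1 ∧ θ * B^2 ≤ ε / 2 := by
    refine ⟨min (1/B) (ε / 2 / B^2), by positivity, ?_, ?_⟩
    · rw [← le_div_iff₀ (by positivity)]; exact min_le_left _ _
    · rw [← le_div_iff₀ (by positivity)]; exact min_le_right _ _
  have hmgf : ∑ k ∈ Finset.range M, w k * Real.exp (θ * (g k - m)) ≤ Real.exp (θ * (ε / 2)) := by
    calc ∑ k ∈ Finset.range M, w k * Real.exp (θ * (g k - m))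
        ≤ ∑ k ∈ Finset.range M, w k * (1 + θ * (g k - m) + θ * (ε/2)) := by
          refine Finset.sum_le_sum fun k hk => mul_le_mul_of_nonneg_left ?_ (hw k)
          have h1 := hgB k hk
          have h2 : |θ * (g k - m)| ≤ θ * B := by rw [abs_mul, abs_of_pos hθ0]; gcongr
          have h3 := (abs_le.1 (Real.abs_exp_sub_one_sub_id_le (h2.trans hθB))).2
          have h4 : (θ * (g k - m))^2 ≤ θ * (ε/2) := by
            calc (θ * (g k - m))^2 = |θ * (g k - m)|^2 := (sq_abs _).symm
              _ ≤ (θ * B)^2 := by gcongr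
              _ = θ * (θ * B^2) := by ring
              _ ≤ _ := by gcongr
          linarith
      _ = ∑ k ∈ Finset.range M, ((1 - θ * m + θ * (ε/2)) * w k + θ * (g k * w k)) :=
          Finset.sum_congr rfl fun k _ => by ring
      _ = 1 + θ * (ε/2) := by
          rw [Finset.sum_add_distrib, ← Finset.mul_sum, ← Finset.mul_sum, hw1, hm]; ring
      _ ≤ _ := by linarith [Real.add_one_le_exp (θ * (ε / 2))]
  have hbd : ∀ N : ℕ, ∑ x ∈ (Fintype.piFinset (fun _ : Fin N => Finset.range M)) with
      N * (m + ε) ≤ ∑ j, g (x j), ∏ j, w (x j) ≤ (Real.exp (-(θ * (ε/2)))) ^ N := by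
    intro N
    have hpn : ∀ x : Fin N → ℕ, 0 ≤ ∏ j, w (x j) := fun x => Finset.prod_nonneg fun j _ => hw _
    calc ∑ x ∈ (Fintype.piFinset (fun _ : Fin N => Finset.range M)) with
          N * (m + ε) ≤ ∑ j, g (x j), ∏ j, w (x j)
        ≤ ∑ x ∈ (Fintype.piFinset (fun _ : Fin N => Finset.range M)) with
          N * (m + ε) ≤ ∑ j, g (x j), (∏ j, w (x j)) * Real.exp (θ * (∑ j, g (x j) - N * (m + ε))) := by
          refine Finset.sum_le_sum fun x hx => le_mul_of_one_le_right (hpn x) ?_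
          rw [Finset.mem_filter] at hx
          exact Real.one_le_exp (mul_nonneg hθ0.le (by linarith [hx.2]))
      _ ≤ ∑ x ∈ (Fintype.piFinset (fun _ : Fin N => Finset.range M)),
          (∏ j, w (x j)) * Real.exp (θ * (∑ j, g (x j) - N * (m + ε))) :=
          Finset.sum_le_sum_of_subset_of_nonneg (Finset.filter_subset _ _) fun x _ _ =>
            mul_nonneg (hpn x) (Real.exp_pos _).le
      _ = ∑ x ∈ (Fintype.piFinset (fun _ : Fin N => Finset.range M)),
          (Real.exp (-(θ * ε)))^N * ∏ j, (w (x j) * Real.exp (θ * (g (x j) - m))) := by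
          refine Finset.sum_congr rfl fun x _ => ?_
          rw [Finset.prod_mul_distrib, ← Real.exp_sum, ← Real.exp_nat_mul, mul_left_comm, ← Real.exp_add]
          congr 2
          rw [← Finset.mul_sum, Finset.sum_sub_distrib]; simp; ring
      _ = (Real.exp (-(θ * ε)))^N * (∑ k ∈ Finset.range M, w k * Real.exp (θ * (g k - m)))^N := by
          rw [← Finset.mul_sum,
            ← Finset.prod_univ_sum (fun _ : Fin N => Finset.range M)
              (fun _ k => w k * Real.exp (θ * (g k - m)))]
          simp
      _ ≤ (Real.exp (-(θ * ε)))^N * (Real.exp (θ * (ε / 2)))^N := by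
          have : 0 ≤ ∑ k ∈ Finset.range M, w k * Real.exp (θ * (g k - m)) :=
            Finset.sum_nonneg fun k _ => mul_nonneg (hw k) (Real.exp_pos _).le
          gcongr
      _ = _ := by rw [← mul_pow, ← Real.exp_add]; ring_nf
  refine squeeze_zero (fun N => Finset.sum_nonneg fun x _ => Finset.prod_nonneg fun j _ => hw _) hbd ?_
  refine tendsto_pow_atTop_nhds_zero_of_lt_one (Real.exp_pos _).le ?_
  rw [Real.exp_lt_one_iff]
  have : 0 < θ * (ε/2) := by positivity
  linarith

lemma chernoff' (M : ℕ) (w g : ℕ → ℝ) (hw : ∀ k, 0 ≤ w k) (hw1 : ∑ k ∈ Finset.range M, w k = 1)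
    (m : ℝ) (hm : ∑ k ∈ Finset.range M, g k * w k = m) (ε : ℝ) (hε : 0 < ε) (η : ℝ) (hη : 0 < η) :
    ∀ᶠ N : ℕ in Filter.atTop, ∑ x ∈ (Fintype.piFinset (fun _ : Fin N => Finset.range M)) with
      ε ≤ |(∑ j, g (x j)) / N - m|, ∏ j, w (x j) < η := by
  have h1 := chernoff M w g hw hw1 m hm ε hε
  have h2 := chernoff M w (fun k => - g k) hw hw1 (-m) (by simp [hm]) ε hε
  have h3 := h1.add h2
  rw [add_zero] at h3
  filter_upwards [h3.eventually (gt_mem_nhds hη), Filter.eventually_gt_atTop 0] with N hN hN0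
  refine lt_of_le_of_lt ?_ hN
  have hNR : (0:ℝ) < N := by exact_mod_cast hN0
  classical
  have hpn : ∀ x : Fin N → ℕ, 0 ≤ ∏ j, w (x j) := fun x => Finset.prod_nonneg fun j _ => hw _
  simp only [Finset.sum_filter]
  rw [← Finset.sum_add_distrib]
  refine Finset.sum_le_sum fun x _ => ?_
  have hp := hpn x
  by_cases h : ε ≤ |(∑ j, g (x j)) / N - m|
  · rw [if_pos h]
    rcases le_abs.1 h with h' | h'
    · have : N * (m + ε) ≤ ∑ j, g (x j) := by
        have : m + ε ≤ (∑ j, g (x j)) / N := by linarith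
        rw [le_div_iff₀ hNR] at this; linarith
      rw [if_pos this]
      have : 0 ≤ (if N * (-m + ε) ≤ ∑ j, - g (x j) then ∏ j, w (x j) else 0) := by
        split_ifs; exacts [hp, le_rfl]
      linarith
    · have : N * (-m + ε) ≤ ∑ j, - g (x j) := by
        have : (∑ j, g (x j)) / N ≤ m - ε := by linarith
        rw [div_le_iff₀ hNR] at this
        rw [Finset.sum_neg_distrib]; linarith
      rw [if_pos this]
      have : 0 ≤ (if N * (m + ε) ≤ ∑ j, g (x j) then ∏ j, w (x j) else 0) := by
        split_ifs; exacts [hp, le_rfl]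
      linarith
  · rw [if_neg h]
    refine add_nonneg ?_ ?_ <;> split_ifs <;> first | exact hp | exact le_rfl

lemma lower_fin (b p : ℝ) (hb : 0 < b) (hp : 0 < p) (κ M : ℕ) (G : Set (ℝ × ℝ × ℝ)) (hG : IsOpen G)
    (w : ℕ → ℝ) (hw : ∀ k, 0 ≤ w k) (hw1 : ∑ k ∈ Finset.range M, w k = 1)
    (hGw : (∑ k ∈ Finset.range M, (k:ℝ) * w k,
      ∑ k ∈ Finset.range M, (if k ≤ κ then (k:ℝ) else 0) * w k,
      ∑ k ∈ Finset.range M, (if k ≤ κ then (1:ℝ) else 0) * w k) ∈ G)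
    (H : ℝ) (hH : ∑ k ∈ Finset.range M, Real.log (w k / poissonPMF (b * p) k) * w k = H)
    (ε : ℝ) (hε : 0 < ε) :
    ∀ᶠ N : ℕ in Filter.atTop, Real.exp (N * -(H + ε)) ≤ probLIB b p κ N G := by
  classical
  set ν := poissonPMF (b * p) with hν
  have hνp : ∀ k, 0 < ν k := poissonPMF_pos' (by positivity)
  obtain ⟨δ, hδ, hball⟩ := Metric.isOpen_iff.1 hG _ hGw
  set h : ℕ → ℝ := fun k => Real.log (w k / ν k) with hh
  have hwν : ∀ k, w k * Real.exp (- h k) ≤ ν k := by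
    intro k
    rcases (hw k).eq_or_lt with h0 | h0
    · rw [← h0]; simpa using (hνp k).le
    · have h1 := hνp k
      simp only [hh]
      rw [Real.exp_neg, Real.exp_log (div_pos h0 h1)]
      apply le_of_eq; field_simp
  have c1 := chernoff' M w (fun k => (k:ℝ)) hw hw1 _ rfl δ hδ (1/8) (by norm_num)
  have c2 := chernoff' M w (fun k => if k ≤ κ then (k:ℝ) else 0) hw hw1 _ rfl δ hδ (1/8) (by norm_num)
  have c3 := chernoff' M w (fun k => if k ≤ κ then (1:ℝ) else 0) hw hw1 _ rfl δ hδ (1/8) (by norm_num)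
  have c4 := chernoff' M w h hw hw1 H hH (ε/3) (by positivity) (1/8) (by norm_num)
  have c5 : ∀ᶠ N : ℕ in Filter.atTop, ∀ k ∈ Finset.range M,
      ν k * Real.exp (-(ε/3)) ≤ binPMF ⌊b * (N : ℝ)⌋₊ (p / (N : ℝ)) k := by
    rw [Filter.eventually_all_finset]
    intro k _
    refine bin_lower b p hb hp k _ ?_
    refine mul_lt_of_lt_one_right (hνp k) ?_
    rw [Real.exp_lt_one_iff]; linarith
  have c6 : ∀ᶠ N : ℕ in Filter.atTop, Real.exp (N * -(ε/3)) ≤ 1/2 := by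
    have h1 : Filter.Tendsto (fun N : ℕ => (Real.exp (-(ε/3)))^N) Filter.atTop (nhds 0) := by
      refine tendsto_pow_atTop_nhds_zero_of_lt_one (Real.exp_pos _).le ?_
      rw [Real.exp_lt_one_iff]; linarith
    filter_upwards [h1.eventually (gt_mem_nhds (show (0:ℝ) < 1/2 by norm_num))] with N hN
    rw [Real.exp_nat_mul]; exact hN.le
  have c7 : ∀ᶠ N : ℕ in Filter.atTop, M ≤ ⌊b * (N : ℝ)⌋₊ + 1 := by
    have h1 : Filter.Tendsto (fun N : ℕ => b * (N:ℝ)) Filter.atTop Filter.atTop :=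
      tendsto_natCast_atTop_atTop.const_mul_atTop hb
    filter_upwards [(tendsto_nat_floor_atTop.comp h1).eventually_ge_atTop M] with N hN
    simp only [Function.comp] at hN
    omega
  filter_upwards [c1, c2, c3, c4, c5, c6, c7, Filter.eventually_gt_atTop 0,
    tendsto_natCast_atTop_atTop.eventually_ge_atTop p] with N c1 c2 c3 c4 c5 c6 c7 hN0 hNp
  have hNR : (0:ℝ) < N := by exact_mod_cast hN0
  rw [probLIB_eq]
  set n := ⌊b * (N : ℝ)⌋₊ with hn
  set q := p / (N:ℝ) with hq
  have hq0 : 0 ≤ q := by positivity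
  have hq1 : q ≤ 1 := by rw [hq, div_le_one hNR]; exact hNp
  have hpn : ∀ x : Fin N → ℕ, 0 ≤ ∏ j, w (x j) := fun x => Finset.prod_nonneg fun j _ => hw _
  set box := Fintype.piFinset (fun _ : Fin N => Finset.range M) with hbox
  set T := box.filter (fun x => trip κ N x ∈ G ∧ (∑ j, h (x j)) / N ≤ H + ε/3) with hT
  have htot : ∑ x ∈ box, ∏ j, w (x j) = 1 := by
    rw [hbox, ← Finset.prod_univ_sum (fun _ : Fin N => Finset.range M) (fun _ k => w k)]
    simp [hw1]
  have hTsum : 1/2 ≤ ∑ x ∈ T, ∏ j, w (x j) := by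
    have : ∑ x ∈ box, ∏ j, w (x j) ≤ ∑ x ∈ T, ∏ j, w (x j) + 1/8 + 1/8 + 1/8 + 1/8 := by
      rw [hT]
      refine le_trans ?_ (add_le_add (add_le_add (add_le_add (add_le_add le_rfl c1.le) c2.le) c3.le) c4.le)
      simp only [Finset.sum_filter]
      rw [← Finset.sum_add_distrib, ← Finset.sum_add_distrib, ← Finset.sum_add_distrib,
        ← Finset.sum_add_distrib]
      refine Finset.sum_le_sum fun x _ => ?_
      have hp0 := hpn x
      have hite : ∀ (P : Prop) [Decidable P], 0 ≤ (if P then ∏ j, w (x j) else 0) := by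
        intro P _; split_ifs; exacts [hp0, le_rfl]
      by_cases d1 : δ ≤ |(∑ j, (x j : ℝ)) / N - ∑ k ∈ Finset.range M, (k:ℝ) * w k|
      · rw [if_pos d1]
        refine le_add_of_le_of_nonneg (le_add_of_le_of_nonneg (le_add_of_le_of_nonneg
          (le_add_of_nonneg_left (hite _)) (hite _)) (hite _)) (hite _)
      by_cases d2 : δ ≤ |(∑ j, (if x j ≤ κ then (x j : ℝ) else 0)) / N -
          ∑ k ∈ Finset.range M, (if k ≤ κ then (k:ℝ) else 0) * w k|
      · rw [if_pos d2]
        refine le_add_of_le_of_nonneg (le_add_of_le_of_nonneg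
          (le_add_of_nonneg_left (add_nonneg (hite _) (hite _))) (hite _)) (hite _)
      by_cases d3 : δ ≤ |(∑ j, (if x j ≤ κ then (1 : ℝ) else 0)) / N -
          ∑ k ∈ Finset.range M, (if k ≤ κ then (1:ℝ) else 0) * w k|
      · rw [if_pos d3]
        refine le_add_of_le_of_nonneg
          (le_add_of_nonneg_left (add_nonneg (add_nonneg (hite _) (hite _)) (hite _))) (hite _)
      by_cases d4 : ε / 3 ≤ |(∑ j, h (x j)) / N - H|
      · rw [if_pos d4]
        exact le_add_of_nonneg_left (add_nonneg (add_nonneg (add_nonneg (hite _) (hite _)) (hite _)) (hite _))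
      rw [not_le] at d1 d2 d3 d4
      have hin : trip κ N x ∈ G ∧ (∑ j, h (x j)) / N ≤ H + ε/3 := by
        constructor
        · apply hball
          rw [Metric.mem_ball]
          unfold trip
          simp only [Prod.dist_eq, Real.dist_eq, max_lt_iff]
          push_cast
          exact ⟨d1, d2, d3⟩
        · linarith [(abs_lt.1 d4).2]
      rw [if_pos hin]
      exact le_add_of_le_of_nonneg (le_add_of_le_of_nonneg (le_add_of_le_of_nonneg
        (le_add_of_le_of_nonneg le_rfl (hite _)) (hite _)) (hite _)) (hite _)
    rw [htot] at this
    linarith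
  have hsub : T ⊆ (Fintype.piFinset (fun _ : Fin N => Finset.range (n + 1))).filter
        (fun x => trip κ N x ∈ G) := by
    intro x hx
    rw [hT, Finset.mem_filter, hbox, Fintype.mem_piFinset] at hx
    rw [Finset.mem_filter, Fintype.mem_piFinset]
    refine ⟨fun j => ?_, hx.2.1⟩
    have := hx.1 j
    rw [Finset.mem_range] at this ⊢
    omega
  calc Real.exp (N * -(H + ε)) = Real.exp (N * -(H + 2 * (ε/3))) * Real.exp (N * -(ε/3)) := by
        rw [← Real.exp_add]; ring_nf
    _ ≤ Real.exp (N * -(H + 2 * (ε/3))) * ∑ x ∈ T, ∏ j, w (x j) := by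
        gcongr; exact c6.trans hTsum
    _ = ∑ x ∈ T, Real.exp (N * -(H + 2 * (ε/3))) * ∏ j, w (x j) := Finset.mul_sum _ _ _
    _ ≤ ∑ x ∈ T, ∏ j, binPMF n q (x j) := by
        refine Finset.sum_le_sum fun x hx => ?_
        rw [hT, Finset.mem_filter, hbox, Fintype.mem_piFinset] at hx
        obtain ⟨hx1, _, hx2⟩ := hx
        rw [div_le_iff₀ hNR] at hx2
        calc Real.exp (N * -(H + 2 * (ε/3))) * ∏ j, w (x j)
            ≤ Real.exp (∑ j, (-h (x j) + -(ε/3))) * ∏ j, w (x j) := by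
              refine mul_le_mul_of_nonneg_right ?_ (hpn x)
              rw [Real.exp_le_exp, Finset.sum_add_distrib, Finset.sum_neg_distrib]
              simp
              linarith
          _ = ∏ j, (w (x j) * Real.exp (- h (x j)) * Real.exp (-(ε/3))) := by
              rw [Real.exp_sum, ← Finset.prod_mul_distrib]
              refine Finset.prod_congr rfl fun j _ => ?_
              rw [Real.exp_add]; ring
          _ ≤ ∏ j, binPMF n q (x j) := by
              refine Finset.prod_le_prod (fun j _ => ?_) fun j _ => ?_
              · have := hw (x j); positivity
              · refine le_trans ?_ (c5 _ (hx1 j))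
                exact mul_le_mul_of_nonneg_right (hwν _) (Real.exp_pos _).le
    _ ≤ _ := Finset.sum_le_sum_of_subset_of_nonneg hsub fun x _ _ =>
        Finset.prod_nonneg fun j _ => binPMF_nonneg _ _ _ hq0 hq1

lemma lower_bound (b p : ℝ) (hb : 0 < b) (hp : 0 < p) (κ : ℕ) (G : Set (ℝ × ℝ × ℝ)) (hG : IsOpen G) :
    -(⨅ x ∈ G, ILIB b p κ x.1 x.2.1 x.2.2)
        ≤ Filter.liminf (fun N : ℕ => (((N : ℝ)⁻¹ : ℝ) : EReal) * elog (probLIB b p κ N G))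
            Filter.atTop := by
  rw [EReal.neg_le]
  refine le_iInf₂ fun x hx => le_sInf ?_
  rintro _ ⟨μ, ⟨hμ0, hμ1⟩, ha, hs, hr, rfl⟩
  obtain ⟨a, s, r⟩ := x
  simp only at ha hs hr
  set ν := poissonPMF (b * p) with hν
  have hνp : ∀ k, 0 < ν k := poissonPMF_pos' (by positivity)
  unfold relEnt
  split_ifs with hcond
  swap
  · exact le_top
  obtain ⟨_, hsum⟩ := hcond
  set h := ∑' k, μ k * Real.log (μ k / ν k) with hh
  have hsum' := hsum.hasSum.tendsto_sum_nat
  rw [← hh] at hsum'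
  rw [EReal.neg_le]
  refine le_of_forall_lt fun z hz => ?_
  obtain ⟨t, ht1, ht2⟩ := EReal.lt_iff_exists_real_btwn.1 hz
  refine ht1.trans_le ?_
  rw [← EReal.coe_neg, EReal.coe_lt_coe_iff] at ht2
  set ε := (-t - h) / 2 with hε
  have hεp : 0 < ε := by rw [hε]; linarith
  have hs' : HasSum (fun k : ℕ => (if k ≤ κ then (k:ℝ) else 0) * μ k) s := by
    rw [← hs]
    have : ∑ k ∈ Finset.range (κ+1), (k:ℝ) * μ k =
        ∑ k ∈ Finset.range (κ+1), (if k ≤ κ then (k:ℝ) else 0) * μ k :=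
      Finset.sum_congr rfl fun k hk => by
        rw [if_pos (by rw [Finset.mem_range] at hk; omega)]
    rw [this]
    exact hasSum_sum_of_ne_finset_zero fun k hk => by
      rw [if_neg (by rw [Finset.mem_range] at hk; omega), zero_mul]
  have hr' : HasSum (fun k : ℕ => (if k ≤ κ then (1:ℝ) else 0) * μ k) r := by
    rw [← hr]
    have : ∑ k ∈ Finset.range (κ+1), μ k =
        ∑ k ∈ Finset.range (κ+1), (if k ≤ κ then (1:ℝ) else 0) * μ k :=
      Finset.sum_congr rfl fun k hk => by
        rw [if_pos (by rw [Finset.mem_range] at hk; omega), one_mul]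
    rw [this]
    exact hasSum_sum_of_ne_finset_zero fun k hk => by
      rw [if_neg (by rw [Finset.mem_range] at hk; omega), zero_mul]
  have hZ := hμ1.tendsto_sum_nat
  have ta := ha.tendsto_sum_nat.div hZ one_ne_zero
  have ts := hs'.tendsto_sum_nat.div hZ one_ne_zero
  have tr := hr'.tendsto_sum_nat.div hZ one_ne_zero
  have tH := (hsum'.div hZ one_ne_zero).sub (hZ.log one_ne_zero)
  rw [div_one] at ta ts tr
  rw [div_one, Real.log_one, sub_zero] at tH
  have tG := ta.prodMk_nhds (ts.prodMk_nhds tr)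
  obtain ⟨M, hMZ, hMG, hMH⟩ := ((hZ.eventually (lt_mem_nhds (show (0:ℝ) < 1 by norm_num))).and
    ((tG.eventually (hG.mem_nhds hx)).and (tH.eventually (gt_mem_nhds (show h < h + ε by linarith))))).exists
  set Z := ∑ k ∈ Finset.range M, μ k with hZdef
  have hdiv : ∀ f : ℕ → ℝ, ∑ k ∈ Finset.range M, f k * (μ k / Z) = (∑ k ∈ Finset.range M, f k * μ k) / Z := by
    intro f; rw [Finset.sum_div]; exact Finset.sum_congr rfl fun k _ => by ring
  have hent : ∑ k ∈ Finset.range M, Real.log (μ k / Z / ν k) * (μ k / Z) =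
      (∑ k ∈ Finset.range M, μ k * Real.log (μ k / ν k)) / Z - Real.log Z := by
    have : ∀ k ∈ Finset.range M, Real.log (μ k / Z / ν k) * (μ k / Z) =
        μ k * Real.log (μ k / ν k) / Z - μ k * (Real.log Z / Z) := by
      intro k _
      rcases (hμ0 k).eq_or_lt with h0 | h0
      · rw [← h0]; simp
      · rw [show μ k / Z / ν k = μ k / ν k / Z by ring,
          Real.log_div (div_pos h0 (hνp k)).ne' hMZ.ne']; ring
    rw [Finset.sum_congr rfl this, Finset.sum_sub_distrib, ← Finset.sum_div, ← Finset.sum_mul]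
    congr 1
    rw [← hZdef]; field_simp
  have hw1 : ∑ k ∈ Finset.range M, μ k / Z = 1 := by
    rw [← Finset.sum_div, ← hZdef, div_self hMZ.ne']
  have hfin := lower_fin b p hb hp κ M G hG (fun k => μ k / Z) (fun k => div_nonneg (hμ0 k) hMZ.le) hw1
    (by rw [hdiv, hdiv, hdiv]; exact hMG) _ hent ε hεp
  refine Filter.le_liminf_of_le (by isBoundedDefault) ?_
  filter_upwards [hfin, Filter.eventually_gt_atTop 0] with N hN hN0
  refine le_elog hN0 (le_trans ?_ hN)
  rw [Real.exp_le_exp]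
  refine mul_le_mul_of_nonneg_left ?_ (Nat.cast_nonneg N)
  have : (∑ k ∈ Finset.range M, μ k * Real.log (μ k / ν k)) / Z - Real.log Z < h + ε := hMH
  rw [hε] at this ⊢
  linarith

/-- LDP for `(1/N)(A_N, S_N, R_N)` in the interference-based model under the local rule. -/
theorem ldp_interference_local (b p : ℝ) (hb : 0 < b) (hp : 0 < p) (κ : ℕ) (hκ : 0 < κ) :
    (∀ F : Set (ℝ × ℝ × ℝ), IsClosed F →
      Filter.limsup (fun N : ℕ => (((N : ℝ)⁻¹ : ℝ) : EReal) * elog (probLIB b p κ N F))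
          Filter.atTop
        ≤ -(⨅ x ∈ F, ILIB b p κ x.1 x.2.1 x.2.2)) ∧
    (∀ G : Set (ℝ × ℝ × ℝ), IsOpen G →
      -(⨅ x ∈ G, ILIB b p κ x.1 x.2.1 x.2.2)
        ≤ Filter.liminf (fun N : ℕ => (((N : ℝ)⁻¹ : ℝ) : EReal) * elog (probLIB b p κ N G))
            Filter.atTop) := by
  exact ⟨fun F _ => upper_bound b p hb hp κ F, fun G hG => lower_bound b p hb hp κ G hG⟩
end

section
/- Fix b,p>0 and κ∈ℕ. Then the sequence (1/N)(A_N,S_N) of rescaled (number of attempts, number of successes) of the multi-channel slotted-ALOHA model under the local rule satisfies a large deviation principle with speed N and rate function I_{L,MC}: for every closed set F⊆ℝ², limsup_{N→∞} (1/N) log P((1/N)(A_N,S_N)∈F) ≤ −inf_F I_{L,MC}, and for every open set G⊆ℝ², liminf_{N→∞} (1/N) log P((1/N)(A_N,S_N)∈G) ≥ −inf_G I_{L,MC}. -/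
open scoped BigOperators

/-- The reference measure `M(i,j)`: the probability that `κ` i.i.d. `Poi_{l}` variables
have sum `i` and that exactly `j` of them are equal to `1`. -/
noncomputable def Mref (l : ℝ) (κ : ℕ) (i j : ℕ) : ℝ :=
  ∑' y : Fin κ → ℕ,
    if (∑ k, y k) = i ∧ (Finset.univ.filter (fun k => y k = 1)).card = j
    then ∏ k, poissonPMF l (y k) else 0

/-- The rate function `I_{L,MC}` of the local-rule multi-channel model:
`I(a,s) = inf { H(ν | M) : ν` a probability measure on
`Ξ = {(i,j) : j ≤ i, j ≤ κ}` with `Σ ν(i,j) i = a, Σ ν(i,j) j = s }`, with `inf ∅ = ⊤`. -/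
noncomputable def ILMC (b p : ℝ) (κ : ℕ) (a s : ℝ) : EReal :=
  sInf { h : EReal | ∃ ν : ℕ × ℕ → ℝ, IsPMF ν ∧
      (∀ x : ℕ × ℕ, ¬(x.2 ≤ x.1 ∧ x.2 ≤ κ) → ν x = 0) ∧
      HasSum (fun x : ℕ × ℕ => (x.1 : ℝ) * ν x) a ∧
      HasSum (fun x : ℕ × ℕ => (x.2 : ℝ) * ν x) s ∧
      h = relEnt ν (fun x : ℕ × ℕ => Mref (b * p / κ) κ x.1 x.2) }

open Classical in
/-- `P((1/N)(A_N, S_N) ∈ E)` in the multi-channel model under the local rule: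
each of the `⌊bN⌋` participants decides in each of the `N` slots with probability `p/N`
to attempt (`Bool` component) and chooses a uniform channel in `{1,…,κ}` (`Fin κ`
component); `A_N` is the number of attempts and `S_N` the number of successes, i.e. of
slot–channel pairs chosen by exactly one attempting participant. -/
noncomputable def probLMC (b p : ℝ) (κ N : ℕ) (E : Set (ℝ × ℝ)) : ℝ :=
  ∑ ω : Fin ⌊b * (N : ℝ)⌋₊ × Fin N → Bool × Fin κ,
    (if ((((Finset.univ.filter (fun q : Fin ⌊b * (N : ℝ)⌋₊ × Fin N =>
              (ω q).1 = true)).card : ℕ) : ℝ) / (N : ℝ),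
         ((∑ j : Fin N, ∑ c : Fin κ,
            (if (Finset.univ.filter (fun i : Fin ⌊b * (N : ℝ)⌋₊ =>
                  ω (i, j) = (true, c))).card = 1 then (1 : ℕ) else 0) : ℕ) : ℝ) / (N : ℝ)) ∈ E
    then ∏ q : Fin ⌊b * (N : ℝ)⌋₊ × Fin N,
        ((if (ω q).1 then p / (N : ℝ) else 1 - p / (N : ℝ)) * (1 / (κ : ℝ))) else 0)


namespace LMC

noncomputable def wt (q : ℝ) {κ : ℕ} (v : Bool × Fin κ) : ℝ :=
  (if v.1 then q else 1 - q) * (1 / (κ : ℝ))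

def cnt {κ n : ℕ} (w : Fin n → Bool × Fin κ) (k : Fin κ) : ℕ :=
  (Finset.univ.filter (fun i => w i = (true, k))).card

def ones {κ : ℕ} (c : Fin κ → ℕ) : ℕ := (Finset.univ.filter (fun k => c k = 1)).card

def stat {κ n : ℕ} (w : Fin n → Bool × Fin κ) : ℕ × ℕ := (∑ k, cnt w k, ones (cnt w))

noncomputable def sw (q : ℝ) {κ n : ℕ} (w : Fin n → Bool × Fin κ) : ℝ := ∏ i, wt q (w i)

noncomputable def chan (q : ℝ) (κ n : ℕ) (c : Fin κ → ℕ) : ℝ :=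
  ∑ w : Fin n → Bool × Fin κ, if cnt w = c then sw q w else 0

noncomputable def mN (q : ℝ) (κ n : ℕ) (x : ℕ × ℕ) : ℝ :=
  ∑ w : Fin n → Bool × Fin κ, if stat w = x then sw q w else 0

lemma cnt_cons {κ n : ℕ} (v : Bool × Fin κ) (w : Fin n → Bool × Fin κ) (k : Fin κ) :
    cnt (Fin.cons v w : Fin (n+1) → Bool × Fin κ) k = (if v = (true, k) then 1 else 0) + cnt w k := by
  unfold cnt
  rw [Finset.card_filter, Finset.card_filter, Fin.sum_univ_succ]
  simp

lemma chan_succ (q : ℝ) (κ n : ℕ) (hκ : 0 < κ) (c : Fin κ → ℕ) :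
    chan q κ (n+1) c = (1 - q) * chan q κ n c +
      ∑ k, (if c k = 0 then 0 else (q / κ) * chan q κ n (Function.update c k (c k - 1))) := by
  have h1 : chan q κ (n+1) c = ∑ v : Bool × Fin κ, ∑ w : Fin n → Bool × Fin κ,
      if cnt (Fin.cons v w : Fin (n+1) → Bool × Fin κ) = c then wt q v * sw q w else 0 := by
    unfold chan
    rw [← Fintype.sum_prod_type', ← (Fin.consEquiv (fun _ : Fin (n+1) => Bool × Fin κ)).sum_comp]
    refine Finset.sum_congr rfl fun x _ => ?_
    change (if cnt (Fin.cons x.1 x.2 : Fin (n+1) → Bool × Fin κ) = c then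
      sw q (Fin.cons x.1 x.2 : Fin (n+1) → Bool × Fin κ) else 0) = _
    have : sw q (Fin.cons x.1 x.2 : Fin (n+1) → Bool × Fin κ) = wt q x.1 * sw q x.2 := by
      unfold sw
      rw [Fin.prod_univ_succ]; simp
    rw [this]
  rw [h1, Fintype.sum_prod_type, Fintype.sum_bool, add_comm]
  congr 1
  · have : ∀ k : Fin κ, (∑ w : Fin n → Bool × Fin κ,
      if cnt (Fin.cons (false, k) w : Fin (n+1) → Bool × Fin κ) = c then wt q (false, k) * sw q w else 0)
       = (1 - q) * (1 / κ) * chan q κ n c := by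
      intro k
      unfold chan
      rw [Finset.mul_sum]
      refine Finset.sum_congr rfl fun w _ => ?_
      have : cnt (Fin.cons (false, k) w : Fin (n+1) → Bool × Fin κ) = cnt w := by
        funext k'; rw [cnt_cons]; simp
      rw [this]; simp [wt]
    rw [Finset.sum_congr rfl fun k _ => this k]
    have hk : (κ : ℝ) ≠ 0 := by positivity
    rw [Finset.sum_const, Finset.card_univ, Fintype.card_fin, nsmul_eq_mul]
    field_simp
  · refine Finset.sum_congr rfl fun k _ => ?_
    split_ifs with h0
    · refine Finset.sum_eq_zero fun w _ => ?_
      rw [if_neg]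
      intro h
      have := congrFun h k
      rw [cnt_cons] at this
      simp [h0] at this
    · unfold chan
      rw [Finset.mul_sum]
      refine Finset.sum_congr rfl fun w _ => ?_
      have : (cnt (Fin.cons (true, k) w : Fin (n+1) → Bool × Fin κ) = c) ↔
          cnt w = Function.update c k (c k - 1) := by
        constructor
        · intro h
          funext k'
          have := congrFun h k'
          rw [cnt_cons] at this
          by_cases hk : k' = k
          · subst hk; simp at this ⊢; omega
          · simp [hk, Ne.symm hk] at this ⊢; exact this
        · intro h
          funext k'
          rw [cnt_cons, h]
          by_cases hk : k' = k
          · subst hk; simp; omega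
          · simp [hk, Ne.symm hk]
      simp only [this]
      simp [wt, div_eq_mul_inv]

lemma chan_formula (q : ℝ) (κ : ℕ) (hκ : 0 < κ) (n : ℕ) : ∀ (c : Fin κ → ℕ),
    chan q κ n c * ∏ k, ((c k).factorial : ℝ) =
      (n.descFactorial (∑ k, c k) : ℝ) * (q / κ) ^ (∑ k, c k) * (1 - q) ^ (n - ∑ k, c k) := by
  induction n with
  | zero =>
    intro c
    by_cases hc : c = 0
    · subst hc
      have : ∀ w : Fin 0 → Bool × Fin κ, cnt w = 0 := by
        intro w; funext k; simp [cnt]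
      simp [chan, sw, this]
    · have h2 : ∑ k, c k ≠ 0 := by
        intro h; apply hc; funext k
        simpa using (Finset.sum_eq_zero_iff.mp h) k (Finset.mem_univ k)
      have : ∀ w : Fin 0 → Bool × Fin κ, cnt w ≠ c := by
        intro w h; apply hc; rw [← h]; funext k; simp [cnt]
      obtain ⟨m, hm⟩ := Nat.exists_eq_succ_of_ne_zero h2
      rw [hm]
      simp [chan, this]
  | succ n ih =>
    intro c
    rw [chan_succ q κ n hκ c, add_mul, mul_assoc, ih c, Finset.sum_mul]
    set m := ∑ k, c k with hm
    have h3 : ∀ k, (if c k = 0 then 0 else (q / κ) * chan q κ n (Function.update c k (c k - 1))) *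
        ∏ k, ((c k).factorial : ℝ) =
        (c k : ℝ) * ((q/κ)^m * (n.descFactorial (m-1) : ℝ) * (1-q)^(n+1-m)) := by
      intro k
      split_ifs with h0
      · simp [h0]
      · have e1 : ∏ k', ((c k').factorial : ℝ) = c k * ∏ k', (((Function.update c k (c k - 1)) k').factorial : ℝ) := by
          rw [← Finset.mul_prod_erase _ _ (Finset.mem_univ k),
            ← Finset.mul_prod_erase _ (fun k' => (((Function.update c k (c k - 1)) k').factorial : ℝ)) (Finset.mem_univ k), ← mul_assoc]
          congr 1
          · simp
            rw [← Nat.mul_factorial_pred h0]; push_cast; rfl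
          · refine Finset.prod_congr rfl fun x hx => ?_
            rw [Function.update_of_ne (Finset.ne_of_mem_erase hx)]
        have e2 : ∑ k', (Function.update c k (c k - 1)) k' + 1 = m := by
          rw [hm, ← Finset.add_sum_erase _ _ (Finset.mem_univ k),
            ← Finset.add_sum_erase _ c (Finset.mem_univ k)]
          have : ∑ x ∈ Finset.univ.erase k, (Function.update c k (c k - 1)) x = ∑ x ∈ Finset.univ.erase k, c x := by
            refine Finset.sum_congr rfl fun x hx => ?_
            rw [Function.update_of_ne (Finset.ne_of_mem_erase hx)]
          rw [this]; simp; omega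
        have e3 := ih (Function.update c k (c k - 1))
        rw [e1]
        set m' := ∑ k', (Function.update c k (c k - 1)) k'
        rw [← e2, show n + 1 - (m' + 1) = n - m' by omega, show m' + 1 - 1 = m' by omega]
        calc _ = (q/κ) * c k * (chan q κ n (Function.update c k (c k - 1)) * ∏ k', (((Function.update c k (c k - 1)) k').factorial : ℝ)) := by ring
          _ = _ := by rw [e3]; ring
    rw [Finset.sum_congr rfl fun k _ => h3 k, ← Finset.sum_mul]
    have h4 : ∑ k, (c k : ℝ) = m := by rw [hm]; push_cast; rfl
    rw [h4]
    have h5 : (1 - q) * ((n.descFactorial m : ℝ) * (q/κ)^m * (1-q)^(n-m)) =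
       (n.descFactorial m : ℝ) * (q/κ)^m * (1-q)^(n+1-m) := by
      by_cases h : m ≤ n
      · rw [show n + 1 - m = (n - m) + 1 by omega]; ring
      · rw [Nat.descFactorial_eq_zero_iff_lt.mpr (by omega)]; simp
    rw [h5]
    have h6 : ((n+1).descFactorial m : ℝ) = n.descFactorial m + m * n.descFactorial (m-1) := by
      rcases Nat.eq_zero_or_pos m with h | h
      · rw [h]; simp
      · obtain ⟨m', hm'⟩ := Nat.exists_eq_succ_of_ne_zero h.ne'
        rw [hm']
        have := Nat.succ_descFactorial n m'
        rw [Nat.succ_descFactorial_succ, Nat.succ_sub_one, Nat.succ_eq_add_one, Nat.descFactorial_succ]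
        push_cast
        by_cases hh : m' ≤ n
        · push_cast [Nat.cast_sub hh]; ring
        · rw [Nat.descFactorial_eq_zero_iff_lt.mpr (by omega)]; simp
    rw [h6]; ring

lemma pois_prod (l : ℝ) (κ : ℕ) (c : Fin κ → ℕ) :
    (∏ k, poissonPMF l (c k)) * ∏ k, ((c k).factorial : ℝ) = Real.exp (-(l * κ)) * l ^ (∑ k, c k) := by
  rw [← Finset.prod_mul_distrib]
  have : ∀ k, poissonPMF l (c k) * ((c k).factorial : ℝ) = Real.exp (-l) * l ^ (c k) := by
    intro k; unfold poissonPMF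
    have := Nat.factorial_ne_zero (c k)
    field_simp
  rw [Finset.prod_congr rfl fun k _ => this k, Finset.prod_mul_distrib, Finset.prod_pow_eq_pow_sum]
  congr 1
  simp [← Real.exp_nat_mul]; ring

lemma chan_upper (b p q : ℝ) (hb : 0 < b) (hp : 0 < p) (κ : ℕ) (hκ : 0 < κ) (n : ℕ) (hq0 : 0 < q) (hq1 : q < 1)
    (h1 : n * q ≤ b * p) (h2 : b * p - q ≤ n * q) (c : Fin κ → ℕ) :
    chan q κ n c ≤ Real.exp q * ((1-q)⁻¹) ^ (∑ k, c k) * ∏ k, poissonPMF (b * p / κ) (c k) := by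
  have hf : 0 < ∏ k, ((c k).factorial : ℝ) := Finset.prod_pos fun k _ => by positivity
  refine le_of_mul_le_mul_right ?_ hf
  rw [chan_formula q κ hκ, mul_assoc (Real.exp q * _), pois_prod]
  have hk : (κ : ℝ) ≠ 0 := by positivity
  rw [show b * p / κ * κ = b * p by field_simp]
  set m := ∑ k, c k
  have hq' : 0 < 1 - q := by linarith
  by_cases h : m ≤ n
  · have e1 : (n.descFactorial m : ℝ) ≤ (n:ℝ)^m := by exact_mod_cast Nat.descFactorial_le_pow n m
    have e2 : (1-q)^(n-m) = (1-q)^n * ((1-q)⁻¹)^m := by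
      rw [pow_sub₀ _ hq'.ne' h, inv_pow]
    have e3 : (1-q)^n ≤ Real.exp (-(n*q)) := by
      rw [show -((n:ℝ)*q) = n * (-q) by ring, Real.exp_nat_mul]
      gcongr
      have := Real.add_one_le_exp (-q); linarith
    have e4 : Real.exp (-(n*q)) ≤ Real.exp q * Real.exp (-(b*p)) := by
      rw [← Real.exp_add]; gcongr; linarith
    calc _ ≤ (n:ℝ)^m * (q/κ)^m * ((Real.exp q * Real.exp (-(b*p))) * ((1-q)⁻¹)^m) := by
          rw [e2]; gcongr; exact e3.trans e4
      _ = (n * q / κ)^m * ((Real.exp q * Real.exp (-(b*p))) * ((1-q)⁻¹)^m) := by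
          rw [← mul_pow]; congr 2; ring
      _ ≤ (b * p / κ)^m * ((Real.exp q * Real.exp (-(b*p))) * ((1-q)⁻¹)^m) := by
          gcongr
      _ = _ := by ring
  · rw [Nat.descFactorial_eq_zero_iff_lt.mpr (by omega)]; simp; positivity

lemma chan_lower (b p q : ℝ) (κ : ℕ) (hκ : 0 < κ) (n : ℕ) (hq0 : 0 < q) (hq1 : q < 1)
    (h1 : n * q ≤ b * p) (h2 : b * p - q ≤ n * q) (c : Fin κ → ℕ) (hm : (∑ k, c k : ℕ) * q ≤ b * p) :
    ((b * p - (∑ k, c k : ℕ) * q) / κ) ^ (∑ k, c k) * Real.exp (-(b * p / (1 - q))) / (∏ k, ((c k).factorial : ℝ))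
      ≤ chan q κ n c := by
  have hf : 0 < ∏ k, ((c k).factorial : ℝ) := Finset.prod_pos fun k _ => by positivity
  rw [div_le_iff₀ hf, chan_formula q κ hκ]
  set m := ∑ k, c k
  have hq' : 0 < 1 - q := by linarith
  have e1 : ((n + 1 - m : ℕ) : ℝ)^m ≤ n.descFactorial m := by exact_mod_cast Nat.pow_sub_le_descFactorial n m
  have e2 : b * p - m * q ≤ ((n + 1 - m : ℕ) : ℝ) * q := by
    have : ((n:ℝ) + 1) - m ≤ ((n + 1 - m : ℕ) : ℝ) := by
      have := Nat.sub_le_iff_le_add.mp (le_refl (n + 1 - m))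
      have : ((n + 1 : ℕ):ℝ) ≤ ((n + 1 - m : ℕ) : ℝ) + m := by exact_mod_cast this
      push_cast at this; linarith
    nlinarith
  have e3 : Real.exp (-(b * p / (1 - q))) ≤ (1-q)^(n-m) := by
    have a1 : (1-q)^n ≤ (1-q)^(n-m) := pow_le_pow_of_le_one hq'.le (by linarith) (by omega)
    refine le_trans ?_ a1
    have a2 : Real.exp (1 - (1-q)⁻¹) ≤ 1 - q := by
      rw [← Real.le_log_iff_exp_le hq']; exact Real.one_sub_inv_le_log_of_pos hq'
    calc _ ≤ Real.exp (n * (1 - (1-q)⁻¹)) := by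
          gcongr
          have : (n:ℝ) * (1 - (1-q)⁻¹) = -(n * q / (1-q)) := by field_simp; ring
          rw [this]
          gcongr
      _ = (Real.exp (1 - (1-q)⁻¹))^n := by rw [Real.exp_nat_mul]
      _ ≤ _ := by gcongr
  calc _ ≤ (((n + 1 - m : ℕ) : ℝ) * q / κ)^m * (1-q)^(n-m) := by
        have : 0 ≤ (b * p - m * q) / κ := div_nonneg (by linarith) (by positivity)
        gcongr
    _ = ((n + 1 - m : ℕ) : ℝ)^m * (q/κ)^m * (1-q)^(n-m) := by
        rw [← mul_pow]; congr 2; ring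
    _ ≤ _ := by gcongr

def box (κ i : ℕ) : Finset (Fin κ → ℕ) := Fintype.piFinset (fun _ => Finset.range (i+1))

lemma mem_box {κ i : ℕ} {c : Fin κ → ℕ} (h : ∑ k, c k = i) : c ∈ box κ i := by
  simp only [box, Fintype.mem_piFinset, Finset.mem_range]
  intro k
  have := Finset.single_le_sum (f := c) (fun _ _ => Nat.zero_le _) (Finset.mem_univ k)
  omega

lemma Mref_eq (l : ℝ) (κ : ℕ) (x : ℕ × ℕ) : Mref l κ x.1 x.2 =
    ∑ c ∈ box κ x.1, if (∑ k, c k) = x.1 ∧ ones c = x.2 then ∏ k, poissonPMF l (c k) else 0 := by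
  unfold Mref
  rw [tsum_eq_sum (s := box κ x.1)]
  · rfl
  · intro c hc
    rw [if_neg]
    rintro ⟨h, -⟩
    exact hc (mem_box h)

lemma mN_eq (q : ℝ) (κ n : ℕ) (x : ℕ × ℕ) : mN q κ n x =
    ∑ c ∈ box κ x.1, if (∑ k, c k) = x.1 ∧ ones c = x.2 then chan q κ n c else 0 := by
  have h1 : ∀ c : Fin κ → ℕ, (if (∑ k, c k) = x.1 ∧ ones c = x.2 then chan q κ n c else 0) =
      ∑ w : Fin n → Bool × Fin κ, if cnt w = c then (if stat w = x then sw q w else 0) else 0 := by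
    intro c
    unfold chan
    split_ifs with h
    · refine Finset.sum_congr rfl fun w _ => ?_
      split_ifs with h1 h2
      · rfl
      · exact absurd (by rw [stat, h1, h.1, h.2]) h2
      · rfl
    · symm
      refine Finset.sum_eq_zero fun w _ => ?_
      split_ifs with h1 h2
      · exact absurd (by rw [← h2, stat, h1]; exact ⟨rfl, rfl⟩) h
      · rfl
      · rfl
  rw [Finset.sum_congr rfl fun c _ => h1 c, Finset.sum_comm]
  unfold mN
  refine Finset.sum_congr rfl fun w _ => ?_
  rw [Finset.sum_ite_eq]
  split_ifs with h1 h2 h2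
  · rfl
  · exact absurd (mem_box (by rw [← h1]; rfl)) h2
  · rfl
  · rfl

lemma poissonPMF_nonneg {l : ℝ} (hl : 0 ≤ l) (k : ℕ) : 0 ≤ poissonPMF l k := by
  unfold poissonPMF; positivity

lemma Mref_nonneg {l : ℝ} (hl : 0 ≤ l) (κ : ℕ) (x : ℕ × ℕ) : 0 ≤ Mref l κ x.1 x.2 := by
  rw [Mref_eq]
  refine Finset.sum_nonneg fun c _ => ?_
  split_ifs
  · exact Finset.prod_nonneg fun k _ => poissonPMF_nonneg hl _
  · rfl

lemma Mref_supp (l : ℝ) (κ : ℕ) (x : ℕ × ℕ) (h : ¬(x.2 ≤ x.1 ∧ x.2 ≤ κ)) : Mref l κ x.1 x.2 = 0 := by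
  rw [Mref_eq]
  refine Finset.sum_eq_zero fun c _ => ?_
  rw [if_neg]
  rintro ⟨h1, h2⟩
  apply h
  rw [← h1, ← h2]
  constructor
  · unfold ones
    rw [Finset.card_filter]
    refine Finset.sum_le_sum fun k _ => ?_
    split_ifs with h <;> omega
  · unfold ones
    refine (Finset.card_le_univ _).trans (by simp)

lemma mN_nonneg {q : ℝ} (hq0 : 0 ≤ q) (hq1 : q ≤ 1) (κ n : ℕ) (x : ℕ × ℕ) : 0 ≤ mN q κ n x := by
  unfold mN
  refine Finset.sum_nonneg fun w _ => ?_
  split_ifs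
  · refine Finset.prod_nonneg fun i _ => ?_
    unfold wt
    refine mul_nonneg ?_ (by positivity)
    split_ifs <;> linarith
  · rfl

lemma mN_upper (b p q : ℝ) (hb : 0 < b) (hp : 0 < p) (κ : ℕ) (hκ : 0 < κ) (n : ℕ) (hq0 : 0 < q) (hq1 : q < 1)
    (h1 : n * q ≤ b * p) (h2 : b * p - q ≤ n * q) (x : ℕ × ℕ) :
    mN q κ n x ≤ Real.exp q * ((1-q)⁻¹) ^ x.1 * Mref (b * p / κ) κ x.1 x.2 := by
  rw [mN_eq, Mref_eq, Finset.mul_sum]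
  refine Finset.sum_le_sum fun c _ => ?_
  split_ifs with h
  · have := chan_upper b p q hb hp κ hκ n hq0 hq1 h1 h2 c
    rwa [h.1] at this
  · simp

lemma floor_bd (b p : ℝ) (hb : 0 < b) (hp : 0 < p) (N : ℕ) (hN : 0 < N) :
    (⌊b * (N:ℝ)⌋₊ : ℝ) * (p / N) ≤ b * p ∧ b * p - p / N ≤ (⌊b * (N:ℝ)⌋₊ : ℝ) * (p / N) := by
  have hN' : (0:ℝ) < N := by exact_mod_cast hN
  have h1 : (⌊b * (N:ℝ)⌋₊ : ℝ) ≤ b * N := Nat.floor_le (by positivity)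
  have h2 : b * N < (⌊b * (N:ℝ)⌋₊ : ℝ) + 1 := Nat.lt_floor_add_one _
  constructor
  · calc _ ≤ (b * N) * (p / N) := by gcongr
      _ = _ := by field_simp
  · have : b * p = (b * N) * (p / N) := by field_simp
    rw [this]
    have h3 : 0 < p / N := by positivity
    nlinarith

open Filter Topology in
lemma tendsto_div_nat (p : ℝ) : Tendsto (fun N : ℕ => p / (N:ℝ)) atTop (𝓝 0) :=
  tendsto_const_div_atTop_nhds_zero_nat p

open Filter Topology in
lemma mN_lower (b p : ℝ) (hb : 0 < b) (hp : 0 < p) (κ : ℕ) (hκ : 0 < κ) (x : ℕ × ℕ) (r : ℝ)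
    (hr : r < Mref (b * p / κ) κ x.1 x.2) :
    ∀ᶠ N : ℕ in atTop, r < mN (p / N) κ ⌊b * (N:ℝ)⌋₊ x := by
  let L : ℝ → (Fin κ → ℕ) → ℝ := fun q c =>
    ((b * p - (∑ k, c k : ℕ) * q) / κ) ^ (∑ k, c k) * Real.exp (-(b * p / (1 - q))) / (∏ k, ((c k).factorial : ℝ))
  have hL : ∀ c, Tendsto (fun N : ℕ => L (p / N) c) atTop (𝓝 (∏ k, poissonPMF (b * p / κ) (c k))) := by
    intro c
    have hf : 0 < ∏ k, ((c k).factorial : ℝ) := Finset.prod_pos fun k _ => by positivity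
    have e : (∏ k, poissonPMF (b * p / κ) (c k)) = L 0 c := by
      have hk : (κ : ℝ) ≠ 0 := by positivity
      simp only [L]
      rw [eq_div_iff hf.ne', pois_prod, show b * p / κ * κ = b * p by field_simp]
      simp; ring
    rw [e]
    have hc : ContinuousAt (fun q => L q c) 0 := by
      simp only [L]
      have : (1:ℝ) - 0 ≠ 0 := by norm_num
      fun_prop (disch := assumption)
    exact hc.tendsto.comp (tendsto_div_nat p)
  have hS : Tendsto (fun N : ℕ => ∑ c ∈ box κ x.1, if (∑ k, c k) = x.1 ∧ ones c = x.2 then L (p / N) c else 0)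
      atTop (𝓝 (Mref (b * p / κ) κ x.1 x.2)) := by
    rw [Mref_eq]
    refine tendsto_finsetSum _ fun c _ => ?_
    split_ifs
    · exact hL c
    · exact tendsto_const_nhds
  have ev1 : ∀ᶠ N : ℕ in atTop, p / (N:ℝ) < 1 := (tendsto_div_nat p).eventually_lt_const one_pos
  have ev2 : ∀ᶠ N : ℕ in atTop, (x.1 : ℝ) * (p / (N:ℝ)) < b * p := by
    have := (tendsto_div_nat p).const_mul (x.1 : ℝ)
    rw [mul_zero] at this
    exact this.eventually_lt_const (by positivity)
  filter_upwards [hS.eventually_const_lt hr, ev1, ev2, eventually_gt_atTop 0] with N h1 h2 h3 h4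
  refine h1.trans_le ?_
  rw [mN_eq]
  refine Finset.sum_le_sum fun c _ => ?_
  split_ifs with h
  · have hf := floor_bd b p hb hp N h4
    exact chan_lower b p (p / N) κ hκ _ (by positivity) h2 hf.1 hf.2 c (by rw [h.1]; exact h3.le)
  · rfl

lemma fiber (q : ℝ) (κ n N : ℕ) (T : Finset (ℕ × ℕ))
    (hT : ∀ w : Fin n → Bool × Fin κ, stat w ∈ T) (Φ : (Fin N → ℕ × ℕ) → ℝ) :
    ∑ w : Fin N → Fin n → Bool × Fin κ, Φ (fun j => stat (w j)) * ∏ j, sw q (w j) =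
    ∑ y ∈ Fintype.piFinset (fun _ : Fin N => T), Φ y * ∏ j, mN q κ n (y j) := by
  have h1 : ∀ y : Fin N → ℕ × ℕ, ∏ j, mN q κ n (y j) =
      ∑ w : Fin N → Fin n → Bool × Fin κ, if (fun j => stat (w j)) = y then ∏ j, sw q (w j) else 0 := by
    intro y
    unfold mN
    rw [Finset.prod_univ_sum, Fintype.piFinset_univ]
    refine Finset.sum_congr rfl fun w _ => ?_
    rw [Finset.prod_ite_zero]
    simp [funext_iff]
  simp_rw [h1, Finset.mul_sum]
  rw [Finset.sum_comm]
  refine Finset.sum_congr rfl fun w _ => ?_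
  simp only [mul_ite, mul_zero]
  rw [Finset.sum_ite_eq, if_pos]
  simp [hT]

/-- the sum vector -/
def tot {N : ℕ} (y : Fin N → ℕ × ℕ) : ℕ × ℕ := (∑ j, (y j).1, ∑ j, (y j).2)

noncomputable def resc (N : ℕ) (z : ℕ × ℕ) : ℝ × ℝ := ((z.1 : ℝ) / N, (z.2 : ℝ) / N)

def swapE (n N : ℕ) (X : Type) : (Fin n × Fin N → X) ≃ (Fin N → Fin n → X) where
  toFun ω j i := ω (i, j)
  invFun w x := w x.2 x.1
  left_inv _ := rfl
  right_inv _ := rfl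

lemma sum_cnt {κ n : ℕ} (w : Fin n → Bool × Fin κ) :
    ∑ k, cnt w k = (Finset.univ.filter (fun i => (w i).1 = true)).card := by
  unfold cnt
  simp_rw [Finset.card_filter]
  rw [Finset.sum_comm]
  refine Finset.sum_congr rfl fun i _ => ?_
  rcases h : w i with ⟨v, k⟩
  cases v <;> simp

open Classical in
lemma prob_eq (b p : ℝ) (κ N : ℕ) (E : Set (ℝ × ℝ)) (T : Finset (ℕ × ℕ))
    (hT : ∀ w : Fin ⌊b * (N : ℝ)⌋₊ → Bool × Fin κ, stat w ∈ T) :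
    probLMC b p κ N E = ∑ y ∈ Fintype.piFinset (fun _ : Fin N => T),
      if resc N (tot y) ∈ E then ∏ j, mN (p / N) κ ⌊b * (N : ℝ)⌋₊ (y j) else 0 := by
  have := fiber (p / N) κ ⌊b * (N : ℝ)⌋₊ N T hT (fun y => if resc N (tot y) ∈ E then 1 else 0)
  simp only [ite_mul, one_mul, zero_mul] at this
  rw [← this]
  unfold probLMC
  refine Fintype.sum_equiv (swapE _ _ _) _ _ fun ω => ?_
  have e1 : (Finset.univ.filter (fun q : Fin ⌊b * (N : ℝ)⌋₊ × Fin N => (ω q).1 = true)).card =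
      ∑ j, (stat (swapE _ _ _ ω j)).1 := by
    simp only [stat, sum_cnt]
    simp_rw [Finset.card_filter]
    rw [Fintype.sum_prod_type, Finset.sum_comm]
    rfl
  have e2 : (∑ j : Fin N, ∑ c : Fin κ,
            (if (Finset.univ.filter (fun i : Fin ⌊b * (N : ℝ)⌋₊ =>
                  ω (i, j) = (true, c))).card = 1 then (1 : ℕ) else 0)) =
      ∑ j, (stat (swapE _ _ _ ω j)).2 := by
    simp only [stat, ones]
    refine Finset.sum_congr rfl fun j _ => ?_
    rw [Finset.card_filter]
    rfl
  have e3 : ∏ q : Fin ⌊b * (N : ℝ)⌋₊ × Fin N,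
        ((if (ω q).1 then p / (N : ℝ) else 1 - p / (N : ℝ)) * (1 / (κ : ℝ))) =
      ∏ j, sw (p / N) (swapE _ _ _ ω j) := by
    rw [Fintype.prod_prod_type, Finset.prod_comm]
    rfl
  rw [e1, e2, e3]
  rfl

lemma mgf (q : ℝ) (κ n : ℕ) (hκ : 0 < κ) (T : Finset (ℕ × ℕ))
    (hT : ∀ w : Fin n → Bool × Fin κ, stat w ∈ T) :
    ∑ x ∈ T, Real.exp x.1 * mN q κ n x = (1 - q + q * Real.exp 1) ^ n := by
  have h1 : ∑ x ∈ T, Real.exp x.1 * mN q κ n x = ∑ w : Fin n → Bool × Fin κ, Real.exp (stat w).1 * sw q w := by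
    unfold mN
    simp_rw [Finset.mul_sum]
    rw [Finset.sum_comm]
    refine Finset.sum_congr rfl fun w _ => ?_
    simp only [mul_ite, mul_zero]
    rw [Finset.sum_ite_eq, if_pos (hT w)]
  have h2 : ∀ w : Fin n → Bool × Fin κ, Real.exp (stat w).1 * sw q w =
      ∏ i, ((if (w i).1 then Real.exp 1 else 1) * wt q (w i)) := by
    intro w
    rw [Finset.prod_mul_distrib]
    congr 1
    simp only [stat, sum_cnt, Finset.card_filter]
    push_cast
    rw [Real.exp_sum]
    refine Finset.prod_congr rfl fun i _ => ?_
    split_ifs <;> simp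
  rw [h1, Finset.sum_congr rfl fun w _ => h2 w,
    ← Fintype.sum_pow (fun v : Bool × Fin κ => (if v.1 then Real.exp 1 else 1) * wt q v) n]
  congr 1
  rw [Fintype.sum_prod_type, Fintype.sum_bool]
  have hk : (κ : ℝ) ≠ 0 := by positivity
  simp [wt]
  field_simp
  ring

/-- Entropy bound. -/
lemma entropy_bound {α : Type*} [DecidableEq α] (M : α → ℝ) (hM : ∀ x, 0 ≤ M x) (N : ℕ) (hN : 0 < N)
    (T : Finset α) (B : Finset (Fin N → α)) (hB : ∀ y ∈ B, ∀ j, y j ∈ T)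
    (hP : 0 < ∑ y ∈ B, ∏ j, M (y j)) :
    ∃ ν : α → ℝ, (∀ x, 0 ≤ ν x) ∧ (∀ x, x ∉ T → ν x = 0) ∧ ∑ x ∈ T, ν x = 1 ∧
      (∀ x, M x = 0 → ν x = 0) ∧
      (∀ (f : α → ℝ) (a : ℝ), (∀ y ∈ B, ∑ j, f (y j) = N * a) → ∑ x ∈ T, f x * ν x = a) ∧
      ∑ y ∈ B, ∏ j, M (y j) ≤ Real.exp (-(N * ∑ x ∈ T, ν x * Real.log (ν x / M x))) := by
  set P := ∑ y ∈ B, ∏ j, M (y j) with hPdef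
  have hN' : (0:ℝ) < N := by exact_mod_cast hN
  let Q : (Fin N → α) → ℝ := fun y => (∏ j, M (y j)) / P
  have hQ0 : ∀ y, 0 ≤ Q y := fun y => div_nonneg (Finset.prod_nonneg fun j _ => hM _) hP.le
  have hQ1 : ∑ y ∈ B, Q y = 1 := by
    simp only [Q]; rw [← Finset.sum_div, ← hPdef, div_self hP.ne']
  let ν : α → ℝ := fun x => (∑ y ∈ B, Q y * ∑ j, if y j = x then 1 else 0) / N
  have hν0 : ∀ x, 0 ≤ ν x := fun x => div_nonneg (Finset.sum_nonneg fun y _ => mul_nonneg (hQ0 y)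
    (Finset.sum_nonneg fun j _ => by split_ifs <;> norm_num)) hN'.le
  have hex : ∀ f : α → ℝ, ∑ x ∈ T, f x * ν x = (∑ y ∈ B, Q y * ∑ j, f (y j)) / N := by
    intro f
    simp only [ν]
    simp_rw [← mul_div_assoc]
    rw [← Finset.sum_div]
    congr 1
    simp_rw [Finset.mul_sum]
    rw [Finset.sum_comm]
    refine Finset.sum_congr rfl fun y hy => ?_
    rw [Finset.sum_comm]
    refine Finset.sum_congr rfl fun j _ => ?_
    simp only [mul_ite, mul_one, mul_zero]
    rw [Finset.sum_ite_eq, if_pos (hB y hy j)]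
    ring
  have hmean : ∀ (f : α → ℝ) (a : ℝ), (∀ y ∈ B, ∑ j, f (y j) = N * a) → ∑ x ∈ T, f x * ν x = a := by
    intro f a h
    rw [hex, Finset.sum_congr rfl fun y hy => by rw [h y hy], ← Finset.sum_mul, hQ1]
    field_simp
  have hsum : ∑ x ∈ T, ν x = 1 := by
    have := hmean (fun _ => 1) 1 (by simp)
    simpa using this
  have hpos : ∀ y ∈ B, 0 < Q y → ∀ j, 0 < M (y j) ∧ 0 < ν (y j) := by
    intro y hy hq j
    constructor
    · refine lt_of_le_of_ne (hM _) fun h => ?_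
      have : Q y = 0 := by
        simp only [Q]; rw [Finset.prod_eq_zero (Finset.mem_univ j) h.symm, zero_div]
      linarith
    · refine div_pos (Finset.sum_pos' (fun y _ => mul_nonneg (hQ0 y)
        (Finset.sum_nonneg fun j _ => by split_ifs <;> norm_num)) ⟨y, hy, mul_pos hq ?_⟩) hN'
      exact Finset.sum_pos' (fun j _ => by split_ifs <;> norm_num) ⟨j, Finset.mem_univ _, by simp⟩
  refine ⟨ν, hν0, ?_, hsum, ?_, hmean, ?_⟩
  · intro x hx
    simp only [ν]
    rw [Finset.sum_eq_zero, zero_div]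
    intro y hy
    rw [Finset.sum_eq_zero, mul_zero]
    intro j _
    rw [if_neg]
    rintro rfl
    exact hx (hB y hy j)
  · intro x hx
    simp only [ν]
    rw [Finset.sum_eq_zero, zero_div]
    intro y hy
    rcases (hQ0 y).eq_or_lt with h | h
    · rw [← h, zero_mul]
    · rw [Finset.sum_eq_zero, mul_zero]
      intro j _
      rw [if_neg]
      rintro rfl
      have := (hpos y hy h j).1
      linarith
  · rw [← Real.log_le_iff_le_exp hP]
    have e1 : N * ∑ x ∈ T, ν x * Real.log (ν x / M x) = ∑ y ∈ B, Q y * ∑ j, Real.log (ν (y j) / M (y j)) := by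
      have := hex (fun x => Real.log (ν x / M x))
      rw [Finset.sum_congr rfl fun x _ => mul_comm (ν x) _, this]
      field_simp
    have e2 : ∀ y ∈ B, Q y * (Real.log P + ∑ j, Real.log (ν (y j) / M (y j))) ≤ ∏ j, ν (y j) - Q y := by
      intro y hy
      rcases (hQ0 y).eq_or_lt with h | h
      · rw [← h]; simp; exact Finset.prod_nonneg fun j _ => hν0 _
      · have hp := hpos y hy h
        have hpν : 0 < ∏ j, ν (y j) := Finset.prod_pos fun j _ => (hp j).2
        have hpM : 0 < ∏ j, M (y j) := Finset.prod_pos fun j _ => (hp j).1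
        have : Real.log P + ∑ j, Real.log (ν (y j) / M (y j)) = Real.log ((∏ j, ν (y j)) / Q y) := by
          rw [← Real.log_prod (fun j _ => (div_pos (hp j).2 (hp j).1).ne'), Finset.prod_div_distrib,
            ← Real.log_mul hP.ne' (div_pos hpν hpM).ne']
          congr 1
          simp only [Q]
          field_simp
        rw [this]
        have := Real.log_le_sub_one_of_pos (div_pos hpν h)
        calc _ ≤ Q y * ((∏ j, ν (y j)) / Q y - 1) := by gcongr
          _ = _ := by field_simp
    have e3 := Finset.sum_le_sum e2
    simp_rw [mul_add] at e3
    rw [Finset.sum_add_distrib, ← Finset.sum_mul, hQ1, ← e1, Finset.sum_sub_distrib, hQ1] at e3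
    have e4 : ∑ y ∈ B, ∏ j, ν (y j) ≤ 1 := by
      calc _ ≤ ∑ y ∈ Fintype.piFinset (fun _ : Fin N => T), ∏ j, ν (y j) := by
            refine Finset.sum_le_sum_of_subset_of_nonneg ?_ fun y _ _ => Finset.prod_nonneg fun j _ => hν0 _
            intro y hy
            simp only [Fintype.mem_piFinset]
            exact hB y hy
        _ = _ := by
            rw [← Finset.prod_univ_sum (fun _ : Fin N => T) (fun _ x => ν x)]
            simp [hsum]
    linarith

lemma pt_upper (b p : ℝ) (hb : 0 < b) (hp : 0 < p) (κ : ℕ) (N : ℕ) (hN : 0 < N)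
    (T : Finset (ℕ × ℕ)) (z : ℕ × ℕ) (h : ℝ) (hI : (h : EReal) ≤ ILMC b p κ (resc N z).1 (resc N z).2) :
    ∑ y ∈ (Fintype.piFinset (fun _ : Fin N => T)).filter (fun y => tot y = z),
      ∏ j, Mref (b * p / κ) κ (y j).1 (y j).2 ≤ Real.exp (-(N * h)) := by
  set M : ℕ × ℕ → ℝ := fun x => Mref (b * p / κ) κ x.1 x.2 with hMdef
  have hM : ∀ x, 0 ≤ M x := fun x => Mref_nonneg (by positivity) κ x
  have hN' : (0:ℝ) < N := by exact_mod_cast hN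
  set B := (Fintype.piFinset (fun _ : Fin N => T)).filter (fun y => tot y = z) with hBdef
  rcases le_or_gt (∑ y ∈ B, ∏ j, M (y j)) 0 with h0 | h0
  · exact h0.trans (Real.exp_pos _).le
  obtain ⟨ν, n0, nT, n1, nac, nmean, nent⟩ := entropy_bound M hM N hN T B (by
    intro y hy j
    have := (Finset.mem_filter.mp hy).1
    simp only [Fintype.mem_piFinset] at this
    exact this j) h0
  refine nent.trans ?_
  have key : ILMC b p κ (resc N z).1 (resc N z).2 ≤ ((∑ x ∈ T, ν x * Real.log (ν x / M x) : ℝ) : EReal) := by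
    refine sInf_le ⟨ν, ⟨n0, ?_⟩, ?_, ?_, ?_, ?_⟩
    · rw [← n1]; exact hasSum_sum_of_ne_finset_zero nT
    · intro x hx
      exact nac x (Mref_supp _ _ _ hx)
    · rw [← nmean (fun x => (x.1 : ℝ)) (resc N z).1]
      · exact hasSum_sum_of_ne_finset_zero fun x hx => by rw [nT x hx, mul_zero]
      · intro y hy
        have := (Finset.mem_filter.mp hy).2
        simp only [resc]
        rw [← this]; simp only [tot]; push_cast; field_simp
    · rw [← nmean (fun x => (x.2 : ℝ)) (resc N z).2]
      · exact hasSum_sum_of_ne_finset_zero fun x hx => by rw [nT x hx, mul_zero]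
      · intro y hy
        have := (Finset.mem_filter.mp hy).2
        simp only [resc]
        rw [← this]; simp only [tot]; push_cast; field_simp
    · have hs : HasSum (fun x => ν x * Real.log (ν x / M x)) (∑ x ∈ T, ν x * Real.log (ν x / M x)) :=
        hasSum_sum_of_ne_finset_zero fun x hx => by rw [nT x hx, zero_mul]
      unfold relEnt
      rw [if_pos ⟨nac, hs.summable⟩, hs.tsum_eq]
  have := EReal.coe_le_coe_iff.mp (hI.trans key)
  gcongr

lemma ones_le {κ : ℕ} (c : Fin κ → ℕ) : ones c ≤ κ := by
  unfold ones
  refine (Finset.card_le_univ _).trans (by simp)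

open Classical in
lemma prob_upper (b p : ℝ) (hb : 0 < b) (hp : 0 < p) (κ : ℕ) (hκ : 0 < κ) (N : ℕ) (hN : 0 < N)
    (hN2 : p / N ≤ 1/2) (C : ℝ) (hC : 0 ≤ C) (F : Set (ℝ × ℝ)) (h : ℝ)
    (hI : ∀ x ∈ F, (h : EReal) ≤ ILMC b p κ x.1 x.2) :
    probLMC b p κ N F ≤ Real.exp (N * (b * p * Real.exp 1 - C)) +
      ((⌊C * N⌋₊ + 1 : ℕ) * (κ * N + 1 : ℕ) : ℝ) * (Real.exp p * Real.exp (2 * p * C) * Real.exp (-(N * h))) := by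
  set n := ⌊b * (N : ℝ)⌋₊ with hn
  set q := p / (N:ℝ) with hq
  have hN' : (0:ℝ) < N := by exact_mod_cast hN
  have hq0 : 0 < q := by positivity
  obtain ⟨hf1, hf2⟩ := floor_bd b p hb hp N hN
  let T : Finset (ℕ × ℕ) := Finset.univ.image (fun w : Fin n → Bool × Fin κ => stat w)
  have hT : ∀ w : Fin n → Bool × Fin κ, stat w ∈ T := fun w => Finset.mem_image_of_mem _ (Finset.mem_univ _)
  have hT2 : ∀ x ∈ T, x.2 ≤ κ := by
    intro x hx
    obtain ⟨w, -, rfl⟩ := Finset.mem_image.mp hx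
    exact ones_le _
  rw [prob_eq b p κ N F T hT]
  set Y := Fintype.piFinset (fun _ : Fin N => T) with hY
  let m : (Fin N → ℕ × ℕ) → ℝ := fun y => ∏ j, mN q κ n (y j)
  have hm0 : ∀ y, 0 ≤ m y := fun y => Finset.prod_nonneg fun j _ => mN_nonneg hq0.le (by linarith) _ _ _
  let Z : Finset (ℕ × ℕ) := Finset.range (⌊C * N⌋₊ + 1) ×ˢ Finset.range (κ * N + 1)
  have s1 : ∀ y ∈ Y, (if resc N (tot y) ∈ F then m y else 0) ≤
      Real.exp (-(C * N)) * (Real.exp (tot y).1 * m y) +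
        ∑ z ∈ Z.filter (fun z => resc N z ∈ F), if tot y = z then m y else 0 := by
    intro y hy
    have a1 : 0 ≤ Real.exp (-(C * N)) * (Real.exp (tot y).1 * m y) := by
      have := hm0 y; positivity
    have a2 : 0 ≤ ∑ z ∈ Z.filter (fun z => resc N z ∈ F), if tot y = z then m y else 0 :=
      Finset.sum_nonneg fun z _ => by split_ifs; exacts [hm0 y, le_rfl]
    split_ifs with hyF
    · by_cases hc : ((tot y).1 : ℝ) ≤ C * N
      · have : tot y ∈ Z.filter (fun z => resc N z ∈ F) := by
          refine Finset.mem_filter.mpr ⟨Finset.mem_product.mpr ⟨?_, ?_⟩, hyF⟩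
          · rw [Finset.mem_range]
            have := Nat.le_floor hc
            omega
          · rw [Finset.mem_range]
            have : ∑ j, (y j).2 ≤ ∑ j : Fin N, κ := Finset.sum_le_sum fun j _ => hT2 _ (by
              simp only [hY, Fintype.mem_piFinset] at hy; exact hy j)
            simp at this
            simp only [tot]
            nlinarith
        rw [Finset.sum_ite_eq, if_pos this]
        linarith
      · push Not at hc
        have : 1 ≤ Real.exp (-(C*N)) * Real.exp (tot y).1 := by
          rw [← Real.exp_add]; apply Real.one_le_exp; linarith
        have := mul_le_mul_of_nonneg_right this (hm0 y)
        linarith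
    · linarith
  refine (Finset.sum_le_sum s1).trans ?_
  rw [Finset.sum_add_distrib]
  refine add_le_add ?_ ?_
  · rw [← Finset.mul_sum]
    have : ∑ y ∈ Y, Real.exp (tot y).1 * m y = ((1 - q + q * Real.exp 1) ^ n) ^ N := by
      rw [← mgf q κ n hκ T hT]
      have := Finset.prod_univ_sum (fun _ : Fin N => T) (fun _ x => Real.exp x.1 * mN q κ n x)
      simp only [Finset.prod_const, Finset.card_univ, Fintype.card_fin] at this
      rw [this]
      refine Finset.sum_congr rfl fun y _ => ?_
      rw [Finset.prod_mul_distrib]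
      simp only [tot, m]
      push_cast
      rw [Real.exp_sum]
    rw [this]
    have b0 : 0 ≤ 1 - q + q * Real.exp 1 := by
      have := Real.exp_pos 1; nlinarith
    have b1 : (1 - q + q * Real.exp 1) ^ n ≤ Real.exp (b * p * Real.exp 1) := by
      calc _ ≤ (Real.exp (q * Real.exp 1)) ^ n := by
            gcongr
            have := Real.add_one_le_exp (q * Real.exp 1)
            linarith
        _ = Real.exp (n * (q * Real.exp 1)) := by rw [← Real.exp_nat_mul]
        _ ≤ _ := by
            rw [← mul_assoc]
            exact Real.exp_le_exp.mpr (mul_le_mul_of_nonneg_right hf1 (Real.exp_pos _).le)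
    calc _ ≤ Real.exp (-(C * N)) * (Real.exp (b * p * Real.exp 1)) ^ N := by gcongr
      _ = _ := by rw [← Real.exp_nat_mul, ← Real.exp_add]; congr 1; ring
  · rw [Finset.sum_comm]
    have hz : ∀ z ∈ Z.filter (fun z => resc N z ∈ F), (∑ y ∈ Y, if tot y = z then m y else 0) ≤
        Real.exp p * Real.exp (2 * p * C) * Real.exp (-(N * h)) := by
      intro z hz
      obtain ⟨hzZ, hzF⟩ := Finset.mem_filter.mp hz
      have hz1 : (z.1 : ℝ) ≤ C * N := by
        have := (Finset.mem_product.mp hzZ).1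
        rw [Finset.mem_range] at this
        exact (Nat.le_floor_iff (by positivity)).mp (by omega)
      rw [← Finset.sum_filter]
      have c1 : ∀ y ∈ Y.filter (fun y => tot y = z), m y ≤
          (Real.exp p * Real.exp (2 * p * C)) * ∏ j, Mref (b * p / κ) κ (y j).1 (y j).2 := by
        intro y hy
        have hyz := (Finset.mem_filter.mp hy).2
        have d1 : m y ≤ ∏ j, (Real.exp q * ((1-q)⁻¹) ^ (y j).1 * Mref (b * p / κ) κ (y j).1 (y j).2) :=
          Finset.prod_le_prod (fun j _ => mN_nonneg hq0.le (by linarith) _ _ _)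
            fun j _ => mN_upper b p q hb hp κ hκ n hq0 (by linarith) hf1 hf2 (y j)
        refine d1.trans ?_
        rw [Finset.prod_mul_distrib, Finset.prod_mul_distrib, Finset.prod_pow_eq_pow_sum]
        refine mul_le_mul_of_nonneg_right ?_ (Finset.prod_nonneg fun j _ => Mref_nonneg (by positivity) κ (y j))
        have d2 : ∏ j : Fin N, Real.exp q = Real.exp p := by
          rw [Finset.prod_const, Finset.card_univ, Fintype.card_fin, ← Real.exp_nat_mul, hq]
          congr 1; field_simp
        rw [d2]
        have d3 : ∑ j, (y j).1 = z.1 := by rw [← hyz]; rfl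
        rw [d3]
        have d4 : (1-q)⁻¹ ≤ Real.exp (2 * q) := by
          have : Real.exp (-(2*q)) ≤ 1 - q := by
            rw [← Real.le_log_iff_exp_le (by linarith)]
            refine le_trans ?_ (Real.one_sub_inv_le_log_of_pos (by linarith))
            have : (1-q)⁻¹ ≤ 1 + 2 * q := by
              rw [inv_le_iff_one_le_mul₀ (by linarith)]
              nlinarith
            linarith
          rw [Real.exp_neg] at this
          exact (inv_le_comm₀ (Real.exp_pos _) (by linarith)).mp this
        have d5 : ((1-q)⁻¹) ^ z.1 ≤ Real.exp (2 * p * C) := by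
          calc _ ≤ (Real.exp (2*q)) ^ z.1 := by
                have : 0 ≤ (1-q)⁻¹ := inv_nonneg.mpr (by linarith)
                gcongr
            _ = Real.exp (z.1 * (2 * q)) := by rw [← Real.exp_nat_mul]
            _ ≤ Real.exp ((C * N) * (2 * q)) := by gcongr
            _ = _ := by congr 1; rw [hq]; field_simp
        gcongr
      refine (Finset.sum_le_sum c1).trans ?_
      rw [← Finset.mul_sum]
      have := pt_upper b p hb hp κ N hN T z h (hI _ hzF)
      gcongr
    refine (Finset.sum_le_card_nsmul _ _ _ hz).trans ?_
    rw [nsmul_eq_mul]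
    gcongr
    have : (Z.filter (fun z => resc N z ∈ F)).card ≤ (⌊C * N⌋₊ + 1) * (κ * N + 1) := by
      refine (Finset.card_filter_le _ _).trans ?_
      simp [Z]
    exact_mod_cast this

open Filter Topology in
lemma elog_upper (u : ℕ → ℝ) (h : ℝ) (K : ℝ) (hK : 0 < K)
    (hu : ∀ᶠ N : ℕ in atTop, u N ≤ K * (N:ℝ) ^ 2 * Real.exp (-(N * h))) :
    limsup (fun N : ℕ => (((N : ℝ)⁻¹ : ℝ) : EReal) * elog (u N)) atTop ≤ ((-h : ℝ) : EReal) := by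
  have ht : Tendsto (fun N : ℕ => (((N:ℝ)⁻¹ * (Real.log K + 2 * Real.log N) - h : ℝ) : EReal)) atTop (𝓝 ((-h : ℝ) : EReal)) := by
    refine (continuous_coe_real_ereal.tendsto _).comp ?_
    have t1 : Tendsto (fun N : ℕ => (N:ℝ)⁻¹) atTop (𝓝 0) := tendsto_inv_atTop_nhds_zero_nat
    have t2 : Tendsto (fun N : ℕ => Real.log N / (N:ℝ)) atTop (𝓝 0) :=
      (Real.isLittleO_log_id_atTop.tendsto_div_nhds_zero).comp tendsto_natCast_atTop_atTop
    have := ((t1.mul_const (Real.log K)).add (t2.const_mul 2)).sub_const h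
    simp only [zero_mul, mul_zero, zero_add, zero_sub] at this
    refine this.congr fun N => ?_
    ring
  rw [← ht.limsup_eq]
  refine limsup_le_limsup ?_
  filter_upwards [hu, eventually_gt_atTop 0] with N h1 h2
  have hN' : (0:ℝ) < N := by exact_mod_cast h2
  unfold elog
  split_ifs with h0
  · rw [EReal.coe_mul_bot_of_pos (by positivity)]; exact bot_le
  · rw [← EReal.coe_mul, EReal.coe_le_coe_iff]
    push Not at h0
    have := Real.log_le_log h0 h1
    rw [Real.log_mul (by positivity) (by positivity), Real.log_mul (by positivity) (by positivity),
      Real.log_exp, Real.log_pow] at this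
    calc _ ≤ (N:ℝ)⁻¹ * (Real.log K + (2:ℕ) * Real.log N + -(N * h)) := by gcongr
      _ = _ := by push_cast; field_simp; ring

open Filter Topology in
lemma upper (b p : ℝ) (hb : 0 < b) (hp : 0 < p) (κ : ℕ) (hκ : 0 < κ) (F : Set (ℝ × ℝ)) :
    limsup (fun N : ℕ => (((N : ℝ)⁻¹ : ℝ) : EReal) * elog (probLMC b p κ N F)) atTop
        ≤ -(⨅ x ∈ F, ILMC b p κ x.1 x.2) := by
  rw [EReal.le_neg]
  refine EReal.ge_of_forall_gt_iff_ge.mp fun h hh => ?_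
  rw [EReal.le_neg, ← EReal.coe_neg]
  have hI : ∀ x ∈ F, (h : EReal) ≤ ILMC b p κ x.1 x.2 := fun x hx =>
    hh.le.trans (iInf₂_le x hx)
  set C := b * p * Real.exp 1 + |h| with hC
  have hC0 : 0 ≤ C := by positivity
  refine elog_upper _ h (1 + (C + 1) * (κ + 1) * (Real.exp p * Real.exp (2 * p * C))) (by positivity) ?_
  have ev1 : ∀ᶠ N : ℕ in atTop, p / (N:ℝ) < 1/2 := (tendsto_div_nat p).eventually_lt_const (by norm_num)
  filter_upwards [ev1, eventually_gt_atTop 0] with N h1 h2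
  refine (prob_upper b p hb hp κ hκ N h2 h1.le C hC0 F h hI).trans ?_
  have hN1 : (1:ℝ) ≤ N := by exact_mod_cast h2
  have a1 : Real.exp (N * (b * p * Real.exp 1 - C)) ≤ 1 * (N:ℝ)^2 * Real.exp (-(N * h)) := by
    have : Real.exp (N * (b * p * Real.exp 1 - C)) ≤ Real.exp (-(N * h)) := by
      rw [Real.exp_le_exp, hC]
      have := le_abs_self h
      nlinarith
    refine this.trans (le_mul_of_one_le_left (Real.exp_pos _).le ?_)
    nlinarith
  have a2 : ((⌊C * N⌋₊ + 1 : ℕ) : ℝ) ≤ (C + 1) * N := by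
    have := Nat.floor_le (a := C * N) (by positivity)
    push_cast; nlinarith
  have a3 : ((κ * N + 1 : ℕ) : ℝ) ≤ (κ + 1) * N := by
    push_cast; nlinarith
  calc _ ≤ 1 * (N:ℝ)^2 * Real.exp (-(N * h)) + (((C + 1) * N) * ((κ + 1) * N)) * (Real.exp p * Real.exp (2 * p * C) * Real.exp (-(N * h))) := by
        gcongr
    _ = _ := by ring

open Filter Topology in
lemma lln {α : Type*} [DecidableEq α] (T : Finset α) (ν : α → ℝ) (h0 : ∀ x, 0 ≤ ν x) (h1 : ∑ x ∈ T, ν x = 1)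
    (g : α → ℝ) (hg : ∑ x ∈ T, ν x * g x = 0) (δ : ℝ) (hδ : 0 < δ) :
    Tendsto (fun N : ℕ => ∑ y ∈ (Fintype.piFinset (fun _ : Fin N => T)).filter
      (fun y => N * δ ≤ ∑ j, g (y j)), ∏ j, ν (y j)) atTop (𝓝 0) := by
  have ht : ∃ t > 0, ∑ x ∈ T, ν x * Real.exp (t * (g x - δ)) < 1 := by
    have hd : HasDerivAt (fun t : ℝ => ∑ x ∈ T, ν x * Real.exp (t * (g x - δ))) (∑ x ∈ T, ν x * (g x - δ)) 0 := by
      refine HasDerivAt.fun_sum fun x _ => ?_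
      have := (((hasDerivAt_id (0:ℝ)).mul_const (g x - δ)).exp).const_mul (ν x)
      simpa using this
    have hv : ∑ x ∈ T, ν x * (g x - δ) = -δ := by
      simp_rw [mul_sub]
      rw [Finset.sum_sub_distrib, hg, ← Finset.sum_mul, h1]; ring
    rw [hv] at hd
    have ev := hd.tendsto_slope_zero_right.eventually_lt_const (show -δ < 0 by linarith)
    obtain ⟨t, ht1, ht2⟩ := (ev.and self_mem_nhdsWithin).exists
    have ht2 : 0 < t := ht2
    refine ⟨t, ht2, ?_⟩
    simp only [zero_add, zero_mul, Real.exp_zero, mul_one, h1, smul_eq_mul] at ht1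
    have : 0 < t⁻¹ := by positivity
    by_contra hcon
    push Not at hcon
    nlinarith
  obtain ⟨t, ht0, ht1⟩ := ht
  set r := ∑ x ∈ T, ν x * Real.exp (t * (g x - δ)) with hr
  have hr0 : 0 ≤ r := Finset.sum_nonneg fun x _ => mul_nonneg (h0 x) (Real.exp_pos _).le
  refine squeeze_zero (fun N => Finset.sum_nonneg fun y _ => Finset.prod_nonneg fun j _ => h0 _) (fun N => ?_)
    (tendsto_pow_atTop_nhds_zero_of_lt_one hr0 ht1)
  have e : r ^ N = ∑ y ∈ Fintype.piFinset (fun _ : Fin N => T), ∏ j, (ν (y j) * Real.exp (t * (g (y j) - δ))) := by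
    rw [← Finset.prod_univ_sum (fun _ : Fin N => T) (fun _ x => ν x * Real.exp (t * (g x - δ)))]
    simp [hr]
  rw [e]
  refine le_trans (Finset.sum_le_sum fun y hy => ?_) (Finset.sum_le_sum_of_subset_of_nonneg (Finset.filter_subset _ _)
    fun y _ _ => Finset.prod_nonneg fun j _ => mul_nonneg (h0 _) (Real.exp_pos _).le)
  have hy2 := (Finset.mem_filter.mp hy).2
  rw [Finset.prod_mul_distrib, ← Real.exp_sum]
  refine le_mul_of_one_le_right (Finset.prod_nonneg fun j _ => h0 _) (Real.one_le_exp ?_)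
  rw [← Finset.mul_sum, Finset.sum_sub_distrib]
  simp
  exact mul_nonneg ht0.le (by linarith)

open Filter Topology Classical in
lemma lln_good {α ι : Type*} [Fintype ι] (T : Finset α) (ν : α → ℝ) (h0 : ∀ x, 0 ≤ ν x) (h1 : ∑ x ∈ T, ν x = 1)
    (f : ι → α → ℝ) (hf : ∀ k, ∑ x ∈ T, ν x * f k x = 0) (δ : ℝ) (hδ : 0 < δ) :
    ∀ᶠ N : ℕ in atTop, 1/2 ≤ ∑ y ∈ (Fintype.piFinset (fun _ : Fin N => T)).filter
      (fun y => ∀ k, ∑ j, f k (y j) < N * δ), ∏ j, ν (y j) := by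
  have ht := tendsto_finsetSum (Finset.univ : Finset ι) fun k _ => lln T ν h0 h1 (f k) (hf k) δ hδ
  rw [Finset.sum_const_zero] at ht
  filter_upwards [ht.eventually_lt_const (show (0:ℝ) < 1/2 by norm_num)] with N hN
  have e : ∑ y ∈ Fintype.piFinset (fun _ : Fin N => T), ∏ j, ν (y j) = 1 := by
    rw [← Finset.prod_univ_sum (fun _ : Fin N => T) (fun _ x => ν x)]
    simp [h1]
  have hp : ∀ y : Fin N → α, 0 ≤ ∏ j, ν (y j) := fun y => Finset.prod_nonneg fun j _ => h0 _
  have s : ∑ y ∈ Fintype.piFinset (fun _ : Fin N => T), ∏ j, ν (y j) ≤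
    ∑ y ∈ Fintype.piFinset (fun _ : Fin N => T), ((if ∀ k, ∑ j, f k (y j) < N * δ then ∏ j, ν (y j) else 0) +
      ∑ k, if N * δ ≤ ∑ j, f k (y j) then ∏ j, ν (y j) else 0) := by
    refine Finset.sum_le_sum fun y _ => ?_
    have hnn : ∀ k, 0 ≤ if N * δ ≤ ∑ j, f k (y j) then ∏ j, ν (y j) else 0 := fun k => by
      split_ifs; exacts [hp y, le_rfl]
    split_ifs with h
    · have := Finset.sum_nonneg fun k (_ : k ∈ Finset.univ) => hnn k
      linarith
    · push Not at h
      obtain ⟨k, hk⟩ := h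
      have := Finset.single_le_sum (fun k _ => hnn k) (Finset.mem_univ k)
      rw [if_pos hk] at this
      linarith
  rw [Finset.sum_add_distrib, Finset.sum_comm, e] at s
  simp_rw [← Finset.sum_filter] at s
  linarith

open Filter Topology Classical in
lemma lower_fin (b p : ℝ) (hb : 0 < b) (hp : 0 < p) (κ : ℕ) (hκ : 0 < κ) (G : Set (ℝ × ℝ)) (hG : IsOpen G)
    (T : Finset (ℕ × ℕ)) (ν : ℕ × ℕ → ℝ) (h0 : ∀ x, 0 ≤ ν x) (h1 : ∑ x ∈ T, ν x = 1)
    (hac : ∀ x, Mref (b * p / κ) κ x.1 x.2 = 0 → ν x = 0) (a s H : ℝ)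
    (ha : ∑ x ∈ T, (x.1 : ℝ) * ν x = a) (hs : ∑ x ∈ T, (x.2 : ℝ) * ν x = s) (has : (a, s) ∈ G)
    (hH : ∑ x ∈ T, ν x * Real.log (ν x / Mref (b * p / κ) κ x.1 x.2) = H) (ε : ℝ) (hε : 0 < ε) :
    ∀ᶠ N : ℕ in atTop, 1/2 * Real.exp (-(N * (H + ε))) ≤ probLMC b p κ N G := by
  obtain ⟨δ, hδ, hball⟩ := Metric.isOpen_iff.mp hG _ has
  set g : ℕ × ℕ → ℝ := fun x => Real.log (ν x / Mref (b * p / κ) κ x.1 x.2) with hg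
  let f : Fin 5 → ℕ × ℕ → ℝ := ![fun x => x.1 - a, fun x => a - x.1, fun x => x.2 - s, fun x => s - x.2,
    fun x => g x - H]
  have hf : ∀ k, ∑ x ∈ T, ν x * f k x = 0 := by
    have ha' : ∑ x ∈ T, ν x * (x.1 : ℝ) = a := by rw [← ha]; exact Finset.sum_congr rfl fun x _ => mul_comm _ _
    have hs' : ∑ x ∈ T, ν x * (x.2 : ℝ) = s := by rw [← hs]; exact Finset.sum_congr rfl fun x _ => mul_comm _ _
    have hH' : ∑ x ∈ T, ν x * g x = H := hH
    intro k
    fin_cases k <;> simp only [f, mul_sub, Finset.sum_sub_distrib, ← Finset.sum_mul, ha', hs', hH', h1,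
      Matrix.cons_val, Fin.reduceFinMk, Fin.isValue, Fin.zero_eta, Fin.mk_one] <;> simp
  set δ' := min δ (ε/2) with hδ'
  have hδ'0 : 0 < δ' := lt_min hδ (by linarith)
  have evm : ∀ᶠ N : ℕ in atTop, ∀ x ∈ T, ν x * Real.exp (-(g x + ε/2)) ≤ mN (p / N) κ ⌊b * (N:ℝ)⌋₊ x := by
    rw [Filter.eventually_all_finset]
    intro x _
    rcases (h0 x).eq_or_lt with h | h
    · have ev1 : ∀ᶠ N : ℕ in atTop, p / (N:ℝ) < 1 := (tendsto_div_nat p).eventually_lt_const one_pos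
      filter_upwards [ev1] with N hN
      rw [← h, zero_mul]
      exact mN_nonneg (by positivity) hN.le _ _ _
    · have hM : 0 < Mref (b * p / κ) κ x.1 x.2 :=
        lt_of_le_of_ne (Mref_nonneg (by positivity) κ x) fun hh => h.ne' (hac x hh.symm)
      refine (mN_lower b p hb hp κ hκ x _ ?_).mono fun N h => h.le
      rw [neg_add, Real.exp_add, Real.exp_neg, hg]
      simp only
      rw [Real.exp_log (div_pos h hM)]
      have : Real.exp (-(ε/2)) < 1 := Real.exp_lt_one_iff.mpr (by linarith)
      calc _ = Mref (b * p / κ) κ x.1 x.2 * Real.exp (-(ε/2)) := by field_simp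
        _ < _ := by nlinarith
  have ev1 : ∀ᶠ N : ℕ in atTop, p / (N:ℝ) < 1 := (tendsto_div_nat p).eventually_lt_const one_pos
  filter_upwards [evm, lln_good T ν h0 h1 f hf δ' hδ'0, ev1, eventually_gt_atTop 0] with N hm hgood hN1 hN0
  have hN' : (0:ℝ) < N := by exact_mod_cast hN0
  let T' : Finset (ℕ × ℕ) := T ∪ Finset.univ.image (fun w : Fin ⌊b * (N:ℝ)⌋₊ → Bool × Fin κ => stat w)
  rw [prob_eq b p κ N G T' fun w => Finset.mem_union_right _ (Finset.mem_image_of_mem _ (Finset.mem_univ _))]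
  rw [← Finset.sum_filter]
  have hmn : ∀ y : Fin N → ℕ × ℕ, 0 ≤ ∏ j, mN (p / N) κ ⌊b * (N:ℝ)⌋₊ (y j) := fun y =>
    Finset.prod_nonneg fun j _ => mN_nonneg (by positivity) hN1.le _ _ _
  calc _ ≤ (∑ y ∈ (Fintype.piFinset (fun _ : Fin N => T)).filter
      (fun y => ∀ k, ∑ j, f k (y j) < N * δ'), ∏ j, ν (y j)) * Real.exp (-(N * (H + ε))) :=
        mul_le_mul_of_nonneg_right (le_of_le_of_eq hgood (by congr!)) (Real.exp_pos _).le
    _ = ∑ y ∈ (Fintype.piFinset (fun _ : Fin N => T)).filter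
      (fun y => ∀ k, ∑ j, f k (y j) < N * δ'), (∏ j, ν (y j)) * Real.exp (-(N * (H + ε))) := by rw [Finset.sum_mul]
    _ ≤ ∑ y ∈ (Fintype.piFinset (fun _ : Fin N => T)).filter
      (fun y => ∀ k, ∑ j, f k (y j) < N * δ'), ∏ j, mN (p / N) κ ⌊b * (N:ℝ)⌋₊ (y j) := by
        refine Finset.sum_le_sum fun y hy => ?_
        obtain ⟨hyT, hyk⟩ := Finset.mem_filter.mp hy
        simp only [Fintype.mem_piFinset] at hyT
        have h4 := hyk 4
        simp only [f, Matrix.cons_val, Finset.sum_sub_distrib, Finset.sum_const, Finset.card_univ, Fintype.card_fin, nsmul_eq_mul] at h4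
        calc _ ≤ (∏ j, ν (y j)) * Real.exp (∑ j, -(g (y j) + ε/2)) := by
              refine mul_le_mul_of_nonneg_left (Real.exp_le_exp.mpr ?_) (Finset.prod_nonneg fun j _ => h0 _)
              rw [Finset.sum_neg_distrib, Finset.sum_add_distrib]
              simp only [Finset.sum_const, Finset.card_univ, Fintype.card_fin, nsmul_eq_mul]
              have : N * δ' ≤ N * (ε/2) := by gcongr; exact min_le_right _ _
              linarith
          _ = ∏ j, (ν (y j) * Real.exp (-(g (y j) + ε/2))) := by rw [Finset.prod_mul_distrib, Real.exp_sum]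
          _ ≤ _ := Finset.prod_le_prod (fun j _ => mul_nonneg (h0 _) (Real.exp_pos _).le) fun j _ => hm _ (hyT j)
    _ ≤ _ := by
        refine Finset.sum_le_sum_of_subset_of_nonneg ?_ fun y _ _ => hmn y
        intro y hy
        obtain ⟨hyT, hyk⟩ := Finset.mem_filter.mp hy
        simp only [Fintype.mem_piFinset] at hyT
        refine Finset.mem_filter.mpr ⟨?_, hball ?_⟩
        · simp only [Fintype.mem_piFinset]
          exact fun j => Finset.mem_union_left _ (hyT j)
        · have k0 := hyk 0
          have k1 := hyk 1
          have k2 := hyk 2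
          have k3 := hyk 3
          simp only [f, Matrix.cons_val, Finset.sum_sub_distrib, Finset.sum_const, Finset.card_univ, Fintype.card_fin, nsmul_eq_mul] at k0 k1 k2 k3
          have hd : N * δ' ≤ N * δ := by gcongr; exact min_le_left _ _
          rw [Metric.mem_ball, Prod.dist_eq, max_lt_iff, Real.dist_eq, Real.dist_eq]
          simp only [resc, tot]
          push_cast
          have aux : ∀ u v : ℝ, u - N * v < N * δ' → N * v - u < N * δ' → |u / N - v| < δ := by
            intro u v h1 h2
            rw [show u / N - v = (u - N * v) / N by field_simp, abs_div, abs_of_pos hN', div_lt_iff₀ hN', abs_lt]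
            constructor <;> linarith
          exact ⟨aux _ _ k0 k1, aux _ _ k2 k3⟩

open Filter Topology in
lemma elog_lower (u : ℕ → ℝ) (h : ℝ)
    (hu : ∀ᶠ N : ℕ in atTop, 1/2 * Real.exp (-(N * h)) ≤ u N) :
    ((-h : ℝ) : EReal) ≤ liminf (fun N : ℕ => (((N : ℝ)⁻¹ : ℝ) : EReal) * elog (u N)) atTop := by
  have ht : Tendsto (fun N : ℕ => (((N:ℝ)⁻¹ * Real.log (1/2) - h : ℝ) : EReal)) atTop (𝓝 ((-h : ℝ) : EReal)) := by
    refine (continuous_coe_real_ereal.tendsto _).comp ?_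
    have t1 : Tendsto (fun N : ℕ => (N:ℝ)⁻¹) atTop (𝓝 0) := tendsto_inv_atTop_nhds_zero_nat
    have := (t1.mul_const (Real.log (1/2))).sub_const h
    simpa only [zero_mul, zero_sub] using this
  rw [← ht.liminf_eq]
  refine liminf_le_liminf ?_
  filter_upwards [hu, eventually_gt_atTop 0] with N h1 h2
  have hN' : (0:ℝ) < N := by exact_mod_cast h2
  have hpos : 0 < 1/2 * Real.exp (-(N * h)) := by positivity
  unfold elog
  rw [if_neg (not_le.mpr (hpos.trans_le h1)), ← EReal.coe_mul, EReal.coe_le_coe_iff]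
  have := Real.log_le_log hpos h1
  rw [Real.log_mul (by positivity) (by positivity), Real.log_exp] at this
  calc _ = (N:ℝ)⁻¹ * (Real.log (1/2) + -(N * h)) := by field_simp; ring
    _ ≤ _ := by gcongr

open Filter Topology in
lemma lower (b p : ℝ) (hb : 0 < b) (hp : 0 < p) (κ : ℕ) (hκ : 0 < κ) (G : Set (ℝ × ℝ)) (hG : IsOpen G) :
    -(⨅ x ∈ G, ILMC b p κ x.1 x.2) ≤
      liminf (fun N : ℕ => (((N : ℝ)⁻¹ : ℝ) : EReal) * elog (probLMC b p κ N G)) atTop := by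
  rw [EReal.neg_le]
  refine le_iInf₂ fun x hx => le_sInf ?_
  rintro h ⟨ν, ⟨h0, h1⟩, hsupp, ha, hs, rfl⟩
  unfold relEnt
  split_ifs with hc
  swap
  · exact le_top
  obtain ⟨hac, hsm⟩ := hc
  set M : ℕ × ℕ → ℝ := fun x => Mref (b * p / κ) κ x.1 x.2 with hM
  set H := ∑' x, ν x * Real.log (ν x / M x) with hH
  have hHs : HasSum (fun x => ν x * Real.log (ν x / M x)) H := hsm.hasSum
  rw [EReal.neg_le]
  refine EReal.ge_of_forall_gt_iff_ge.mp fun r hr => ?_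
  rw [← EReal.coe_neg, EReal.coe_lt_coe_iff] at hr
  have hε : 0 < (-r - H) / 2 := by linarith
  set ε := (-r - H) / 2 with hεd
  have t0 : Tendsto (fun T : Finset (ℕ × ℕ) => ∑ x ∈ T, ν x) atTop (𝓝 1) := h1
  have ta : Tendsto (fun T : Finset (ℕ × ℕ) => (∑ x ∈ T, (x.1:ℝ) * ν x) / ∑ x ∈ T, ν x) atTop (𝓝 x.1) := by
    have := Tendsto.div ha t0 one_ne_zero; rwa [div_one] at this
  have ts : Tendsto (fun T : Finset (ℕ × ℕ) => (∑ x ∈ T, (x.2:ℝ) * ν x) / ∑ x ∈ T, ν x) atTop (𝓝 x.2) := by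
    have := Tendsto.div hs t0 one_ne_zero; rwa [div_one] at this
  have tH : Tendsto (fun T : Finset (ℕ × ℕ) => (∑ x ∈ T, ν x * Real.log (ν x / M x)) / (∑ x ∈ T, ν x)
      - Real.log (∑ x ∈ T, ν x)) atTop (𝓝 H) := by
    have := (Tendsto.div hHs t0 one_ne_zero).sub (t0.log one_ne_zero)
    rwa [div_one, Real.log_one, sub_zero] at this
  have evG := (ta.prodMk_nhds ts).eventually (hG.mem_nhds hx)
  obtain ⟨T, hT0, hTG, hTH⟩ := ((t0.eventually_const_lt (zero_lt_one)).and
    (evG.and (tH.eventually_lt_const (show H < H + ε by linarith)))).exists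
  set Z := ∑ x ∈ T, ν x with hZ
  have hfin := lower_fin b p hb hp κ hκ G hG T (fun x => ν x / Z) (fun x => div_nonneg (h0 x) hT0.le)
    (by rw [← Finset.sum_div, div_self hT0.ne']) (fun x hx => by rw [hac x hx, zero_div])
    ((∑ x ∈ T, (x.1:ℝ) * ν x) / Z) ((∑ x ∈ T, (x.2:ℝ) * ν x) / Z)
    ((∑ x ∈ T, ν x * Real.log (ν x / M x)) / Z - Real.log Z)
    (by rw [Finset.sum_div]; exact Finset.sum_congr rfl fun x _ => by ring)
    (by rw [Finset.sum_div]; exact Finset.sum_congr rfl fun x _ => by ring)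
    hTG
    (by
      have : ∀ x ∈ T, ν x / Z * Real.log (ν x / Z / M x) =
          ν x * Real.log (ν x / M x) / Z - ν x * (Real.log Z / Z) := by
        intro x _
        rcases (h0 x).eq_or_lt with h | h
        · simp [← h]
        · have hMx : M x ≠ 0 := fun hh => h.ne' (hac x hh)
          rw [show ν x / Z / M x = (ν x / M x) / Z by ring, Real.log_div (div_ne_zero h.ne' hMx) hT0.ne']
          ring
      rw [Finset.sum_congr rfl this, Finset.sum_sub_distrib, ← Finset.sum_mul, ← hZ, Finset.sum_div]
      congr 1
      field_simp) ε hε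
  have := elog_lower _ _ hfin
  refine le_trans ?_ this
  rw [EReal.coe_le_coe_iff]
  linarith

end LMC

/-- LDP for `(1/N)(A_N, S_N)` in the multi-channel model under the local rule. -/
theorem ldp_multichannel_local (b p : ℝ) (hb : 0 < b) (hp : 0 < p) (κ : ℕ) (hκ : 0 < κ) :
    (∀ F : Set (ℝ × ℝ), IsClosed F →
      Filter.limsup (fun N : ℕ => (((N : ℝ)⁻¹ : ℝ) : EReal) * elog (probLMC b p κ N F))
          Filter.atTop
        ≤ -(⨅ x ∈ F, ILMC b p κ x.1 x.2)) ∧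
    (∀ G : Set (ℝ × ℝ), IsOpen G →
      -(⨅ x ∈ G, ILMC b p κ x.1 x.2)
        ≤ Filter.liminf (fun N : ℕ => (((N : ℝ)⁻¹ : ℝ) : EReal) * elog (probLMC b p κ N G))
            Filter.atTop) := by
  exact ⟨fun F _ => LMC.upper b p hb hp κ hκ F, fun G hG => LMC.lower b p hb hp κ hκ G hG⟩
end

section
/- Fix b>0, κ∈ℕ and p∈(0,1). Then the rate functions I_{L,IB} and I_{G,IB} are nonnegative, and each of them vanishes at exactly one point, namely the triple (a_IB, s_IB, r_IB) with a_IB = bp, s_IB = e^{−bp} Σ_{i=0}^κ i·(bp)^i/i! = bp·e^{−bp} Σ_{i=0}^{κ−1} (bp)^i/i!, and r_IB = e^{−bp} Σ_{i=0}^κ (bp)^i/i!. In particular this triple is the unique minimizer of both I_{L,IB} and I_{G,IB}. -/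
open scoped BigOperators

/-- The rate function `I_{G,IB}` of the global-rule interference-based model
(for `a ∈ (0,b)`). -/
noncomputable def IGIB (b p : ℝ) (κ : ℕ) (a s r : ℝ) : EReal :=
  ILIB b p κ a s r + (((b - a) * Real.log ((1 - a / b) / (1 - p)) + a - b * p : ℝ) : EReal)


theorem aux_young (x y g : ℝ) (hx : 0 ≤ x) (hy : 0 < y) :
    x * g - y * Real.exp g + x ≤ x * Real.log (x / y) := by
  rcases hx.eq_or_lt with h | h
  · subst h
    have := mul_pos hy (Real.exp_pos g)
    simp; linarith
  · have h1 : Real.log (y * Real.exp g / x) ≤ y * Real.exp g / x - 1 :=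
      Real.log_le_sub_one_of_pos (by positivity)
    have h2 : Real.log (y * Real.exp g / x) = g - Real.log (x / y) := by
      rw [Real.log_div (by positivity) (by positivity), Real.log_mul (by positivity) (by positivity),
        Real.log_exp, Real.log_div (by positivity) (by positivity)]
      ring
    rw [h2] at h1
    have h3 := mul_le_mul_of_nonneg_left h1 hx
    have h4 : x * (y * Real.exp g / x - 1) = y * Real.exp g - x := by field_simp
    rw [h4] at h3
    linarith

theorem aux_relEnt (μ ν g : ℕ → ℝ) (Z m : ℝ) (hμ : IsPMF μ) (hν : ∀ k, 0 < ν k)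
    (hZ : HasSum (fun k => ν k * Real.exp (g k)) Z) (hm : HasSum (fun k => μ k * g k) m) :
    ((m - Z + 1 : ℝ) : EReal) ≤ relEnt μ ν := by
  unfold relEnt
  split_ifs with h
  · rw [EReal.coe_le_coe_iff]
    exact hasSum_le (fun k => aux_young (μ k) (ν k) (g k) (hμ.1 k) (hν k))
      ((hm.sub hZ).add hμ.2) h.2.hasSum
  · exact le_top

theorem aux_deriv (G : ℝ → ℝ) (c m : ℝ) (h0 : G 0 = 0) (hd : HasDerivAt G m 0)
    (h : ∀ t, t * c ≤ G t) : c = m := by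
  have h1 : HasDerivAt (fun t => G t - t * c) (m - 1 * c) 0 :=
    hd.sub ((hasDerivAt_id 0).mul_const c)
  have h2 : IsLocalMin (fun t => G t - t * c) 0 := by
    apply Filter.Eventually.of_forall
    intro t
    simp only [h0]
    have := h t
    linarith
  have := h2.hasDerivAt_eq_zero h1
  linarith

theorem aux_poi_pos (l : ℝ) (hl : 0 < l) (k : ℕ) : 0 < poissonPMF l k := by
  unfold poissonPMF; positivity

theorem aux_poi_exp (l t : ℝ) :
    HasSum (fun k : ℕ => poissonPMF l k * Real.exp (t * k)) (Real.exp (l * Real.exp t - l)) := by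
  have h := NormedSpace.expSeries_div_hasSum_exp (l * Real.exp t)
  rw [← Real.exp_eq_exp_ℝ] at h
  have h2 := h.mul_left (Real.exp (-l))
  rw [← Real.exp_add] at h2
  have e1 : (fun k : ℕ => poissonPMF l k * Real.exp (t * k)) =
      fun k => Real.exp (-l) * ((l * Real.exp t) ^ k / (Nat.factorial k : ℝ)) := by
    funext k
    unfold poissonPMF
    rw [mul_pow, ← Real.exp_nat_mul, mul_comm t]
    ring
  have e2 : l * Real.exp t - l = -l + l * Real.exp t := by ring
  rw [e1, e2]
  exact h2

theorem aux_poi_sum (l : ℝ) : HasSum (poissonPMF l) 1 := by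
  simpa using aux_poi_exp l 0

theorem aux_poi_succ (l : ℝ) (k : ℕ) :
    ((k + 1 : ℕ) : ℝ) * poissonPMF l (k + 1) = l * poissonPMF l k := by
  unfold poissonPMF
  rw [Nat.factorial_succ, pow_succ]
  push_cast
  have : (k : ℝ) + 1 ≠ 0 := by positivity
  field_simp

theorem aux_poi_mean (l : ℝ) : HasSum (fun k : ℕ => (k : ℝ) * poissonPMF l k) l := by
  rw [← hasSum_nat_add_iff' 1]
  simp only [aux_poi_succ]
  simpa using (aux_poi_sum l).mul_left l

theorem aux_lower (b p : ℝ) (hl : 0 < b * p) (κ : ℕ) (a s r : ℝ) (g : ℕ → ℝ) (Z m : ℝ)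
    (hZ : HasSum (fun k => poissonPMF (b * p) k * Real.exp (g k)) Z)
    (hm : ∀ μ : ℕ → ℝ, HasSum (fun k : ℕ => (k : ℝ) * μ k) a →
      (∑ k ∈ Finset.range (κ + 1), (k : ℝ) * μ k) = s →
      (∑ k ∈ Finset.range (κ + 1), μ k) = r → HasSum (fun k => μ k * g k) m) :
    ((m - Z + 1 : ℝ) : EReal) ≤ ILIB b p κ a s r := by
  apply le_sInf
  rintro h ⟨μ, h1, h2, h3, h4, rfl⟩
  exact aux_relEnt μ _ g Z m h1 (aux_poi_pos _ hl) hZ (hm μ h2 h3 h4)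

theorem aux_nonneg (b p : ℝ) (hl : 0 < b * p) (κ : ℕ) (a s r : ℝ) :
    0 ≤ ILIB b p κ a s r := by
  have := aux_lower b p hl κ a s r (fun _ => 0) 1 0 (by simpa using aux_poi_sum (b * p))
    (fun μ _ _ _ => by simpa using (hasSum_zero : HasSum (fun _ : ℕ => (0:ℝ)) 0))
  simpa using this

theorem aux_a (b p : ℝ) (hl : 0 < b * p) (κ : ℕ) (a s r : ℝ) (h : ILIB b p κ a s r = 0) :
    a = b * p := by
  apply aux_deriv (fun t => Real.exp (b * p * Real.exp t - b * p) - 1) a (b * p) (by simp)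
  · have := ((((Real.hasDerivAt_exp 0).const_mul (b * p)).sub_const (b * p)).exp).sub_const 1
    simpa using this
  · intro t
    have := aux_lower b p hl κ a s r (fun k => t * k) _ (t * a) (aux_poi_exp (b * p) t)
      (fun μ h1 _ _ => by
        have e : (fun k : ℕ => μ k * (t * k)) = fun k : ℕ => t * ((k : ℝ) * μ k) := by
          funext k; ring
        rw [e]
        exact h1.mul_left t)
    rw [h, ← EReal.coe_zero, EReal.coe_le_coe_iff] at this
    linarith

theorem aux_fin (b p : ℝ) (hl : 0 < b * p) (κ : ℕ) (a s r : ℝ) (h : ILIB b p κ a s r = 0)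
    (f : ℕ → ℝ) (m : ℝ)
    (hm : ∀ μ : ℕ → ℝ, (∑ k ∈ Finset.range (κ + 1), (k : ℝ) * μ k) = s →
      (∑ k ∈ Finset.range (κ + 1), μ k) = r → ∑ k ∈ Finset.range (κ + 1), f k * μ k = m) :
    m = ∑ k ∈ Finset.range (κ + 1), f k * poissonPMF (b * p) k := by
  apply aux_deriv (fun t => ∑ k ∈ Finset.range (κ + 1),
    poissonPMF (b * p) k * (Real.exp (t * f k) - 1)) _ _ (by simp)
  · apply HasDerivAt.fun_sum
    intro k _
    have := ((((hasDerivAt_id (0:ℝ)).mul_const (f k)).exp).sub_const 1).const_mul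
      (poissonPMF (b * p) k)
    simpa [mul_comm] using this
  · intro t
    have := aux_lower b p hl κ a s r
      (fun k => if k ∈ Finset.range (κ + 1) then t * f k else 0)
      (1 + ∑ k ∈ Finset.range (κ + 1), poissonPMF (b * p) k * (Real.exp (t * f k) - 1)) (t * m)
      (by
        have h1 : HasSum (fun k => if k ∈ Finset.range (κ + 1) then
            poissonPMF (b * p) k * (Real.exp (t * f k) - 1) else 0)
            (∑ k ∈ Finset.range (κ + 1), poissonPMF (b * p) k * (Real.exp (t * f k) - 1)) := by
          rw [← Finset.sum_congr rfl (fun k hk => if_pos hk)]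
          exact hasSum_sum_of_ne_finset_zero (fun k hk => if_neg hk)
        convert (aux_poi_sum (b * p)).add h1 using 2 with k
        split_ifs
        · ring
        · simp)
      (fun μ _ h2 h3 => by
        rw [← hm μ h2 h3, Finset.mul_sum]
        have h1 : HasSum (fun k => if k ∈ Finset.range (κ + 1) then t * (f k * μ k) else 0)
            (∑ k ∈ Finset.range (κ + 1), t * (f k * μ k)) := by
          rw [← Finset.sum_congr rfl (fun k hk => if_pos hk)]
          exact hasSum_sum_of_ne_finset_zero (fun k hk => if_neg hk)
        convert h1 using 2 with k
        split_ifs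
        · ring
        · simp)
    rw [h, ← EReal.coe_zero, EReal.coe_le_coe_iff] at this
    linarith

theorem aux_s (l : ℝ) (n : ℕ) : ∑ k ∈ Finset.range n, (k : ℝ) * poissonPMF l k =
    Real.exp (-l) * ∑ i ∈ Finset.range n, (i : ℝ) * l ^ i / (Nat.factorial i : ℝ) := by
  rw [Finset.mul_sum]
  refine Finset.sum_congr rfl fun k _ => ?_
  unfold poissonPMF; ring

theorem aux_r (l : ℝ) (n : ℕ) : ∑ k ∈ Finset.range n, poissonPMF l k =
    Real.exp (-l) * ∑ i ∈ Finset.range n, l ^ i / (Nat.factorial i : ℝ) := by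
  rw [Finset.mul_sum]
  refine Finset.sum_congr rfl fun k _ => ?_
  unfold poissonPMF; ring

theorem aux_zero (b p : ℝ) (hl : 0 < b * p) (κ : ℕ) :
    ILIB b p κ (b * p) (∑ k ∈ Finset.range (κ + 1), (k : ℝ) * poissonPMF (b * p) k)
      (∑ k ∈ Finset.range (κ + 1), poissonPMF (b * p) k) = 0 := by
  refine le_antisymm ?_ (aux_nonneg b p hl κ _ _ _)
  apply sInf_le
  refine ⟨poissonPMF (b * p), ⟨fun k => (aux_poi_pos _ hl k).le, aux_poi_sum _⟩,
    aux_poi_mean _, rfl, rfl, ?_⟩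
  have h : ∀ k, poissonPMF (b * p) k * Real.log (poissonPMF (b * p) k / poissonPMF (b * p) k) = 0 := by
    intro k
    rw [div_self (aux_poi_pos _ hl k).ne']; simp
  unfold relEnt
  simp only [h]
  have hs : Summable (fun x => poissonPMF (b * p) x *
      Real.log (poissonPMF (b * p) x / poissonPMF (b * p) x)) := by
    rw [funext h]; exact summable_zero
  rw [if_pos (And.intro (fun _ hx => hx) hs), tsum_zero, EReal.coe_zero]

theorem aux_iff (b p : ℝ) (hl : 0 < b * p) (κ : ℕ) (a s r : ℝ) :
    ILIB b p κ a s r = 0 ↔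
      (a, s, r) = (b * p,
        Real.exp (-(b * p)) * ∑ i ∈ Finset.range (κ + 1), (i : ℝ) * (b * p) ^ i / (Nat.factorial i : ℝ),
        Real.exp (-(b * p)) * ∑ i ∈ Finset.range (κ + 1), (b * p) ^ i / (Nat.factorial i : ℝ)) := by
  rw [← aux_s, ← aux_r]
  constructor
  · intro h
    have h1 := aux_a b p hl κ a s r h
    have h2 := aux_fin b p hl κ a s r h (fun k => k) s (fun μ h _ => h)
    have h3 := aux_fin b p hl κ a s r h (fun _ => 1) r (fun μ _ h => by simpa using h)
    simp only [one_mul] at h3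
    rw [← h1] at h2 h3 ⊢
    rw [← h2, ← h3]
  · intro h
    simp only [Prod.mk.injEq] at h
    obtain ⟨rfl, rfl, rfl⟩ := h
    exact aux_zero b p hl κ

theorem aux_extra (b p a : ℝ) (hb : 0 < b) (hp : p < 1) (ha : a < b) :
    0 ≤ (b - a) * Real.log ((1 - a / b) / (1 - p)) + a - b * p := by
  have h1 : 0 < 1 - p := by linarith
  have h := aux_young (b - a) (b * (1 - p)) 0 (by linarith) (by positivity)
  have h2 : (b - a) / (b * (1 - p)) = (1 - a / b) / (1 - p) := by
    field_simp
  rw [h2] at h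
  simp at h
  linarith

/-- The rate functions `I_{L,IB}` and `I_{G,IB}` are nonnegative and vanish exactly at the
point `(a_IB, s_IB, r_IB)` with `a_IB = bp`,
`s_IB = e^{−bp} Σ_{i=0}^κ i (bp)^i/i! = bp e^{−bp} Σ_{i=0}^{κ−1} (bp)^i/i!` and
`r_IB = e^{−bp} Σ_{i=0}^κ (bp)^i/i!`; in particular this triple is the unique minimizer
of both rate functions. -/
theorem rate_function_IB_unique_minimizer (b p : ℝ) (hb : 0 < b)
    (hp : p ∈ Set.Ioo (0 : ℝ) 1) (κ : ℕ) (hκ : 0 < κ) :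
    Real.exp (-(b * p)) * ∑ i ∈ Finset.range (κ + 1), (i : ℝ) * (b * p) ^ i / (Nat.factorial i : ℝ)
      = b * p * Real.exp (-(b * p)) * ∑ i ∈ Finset.range κ, (b * p) ^ i / (Nat.factorial i : ℝ) ∧
    (∀ a s r : ℝ, 0 ≤ ILIB b p κ a s r) ∧
    (∀ a s r : ℝ, a ∈ Set.Ioo 0 b → 0 ≤ IGIB b p κ a s r) ∧
    (∀ a s r : ℝ, ILIB b p κ a s r = 0 ↔
      (a, s, r) = (b * p,
        Real.exp (-(b * p)) * ∑ i ∈ Finset.range (κ + 1), (i : ℝ) * (b * p) ^ i / (Nat.factorial i : ℝ),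
        Real.exp (-(b * p)) * ∑ i ∈ Finset.range (κ + 1), (b * p) ^ i / (Nat.factorial i : ℝ))) ∧
    (∀ a s r : ℝ, a ∈ Set.Ioo 0 b → (IGIB b p κ a s r = 0 ↔
      (a, s, r) = (b * p,
        Real.exp (-(b * p)) * ∑ i ∈ Finset.range (κ + 1), (i : ℝ) * (b * p) ^ i / (Nat.factorial i : ℝ),
        Real.exp (-(b * p)) * ∑ i ∈ Finset.range (κ + 1), (b * p) ^ i / (Nat.factorial i : ℝ)))) := by
  have hl : 0 < b * p := mul_pos hb hp.1
  have hle : ∀ a s r : ℝ, a ∈ Set.Ioo 0 b → ILIB b p κ a s r ≤ IGIB b p κ a s r := by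
    intro a s r ha
    have h := aux_extra b p a hb hp.2 ha.2
    unfold IGIB
    exact le_add_of_nonneg_right (by exact_mod_cast h)
  refine ⟨?_, aux_nonneg b p hl κ, fun a s r ha => (aux_nonneg b p hl κ a s r).trans (hle a s r ha),
    aux_iff b p hl κ, ?_⟩
  · rw [← aux_s, mul_assoc, ← aux_r, Finset.sum_range_succ', Finset.mul_sum]
    simp only [aux_poi_succ]
    simp
  · intro a s r ha
    rw [← aux_iff b p hl κ]
    constructor
    · intro h
      exact le_antisymm (h ▸ hle a s r ha) (aux_nonneg b p hl κ a s r)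
    · intro h
      have h1 := aux_a b p hl κ a s r h
      have h2 : (b - a) * Real.log ((1 - a / b) / (1 - p)) + a - b * p = 0 := by
        have h3 : 1 - p ≠ 0 := by linarith [hp.2]
        rw [h1, mul_div_cancel_left₀ _ hb.ne', div_self h3]; simp
      unfold IGIB
      rw [h, h2]; simp
end

section
/- Fix b>0 and κ∈ℕ. Then there is exactly one p_*∈(0,∞) maximizing the function p ↦ s_IB(p,κ) on (0,∞); it is characterised as the unique p∈(0,∞) satisfying (bp)^κ/(κ−1)! = Σ_{i=0}^{κ−1} (bp)^i/i!. Moreover, p ↦ s_IB(p,κ) is strictly increasing on (0,p_*] and strictly decreasing on [p_*,∞). -/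
open scoped BigOperators

/-- The expected throughput of the interference-based slotted-ALOHA model:
`s_IB(p,κ) = bp·e^{−bp}·Σ_{i=0}^{κ−1} (bp)^i/i!`. -/
noncomputable def sIB (b : ℝ) (κ : ℕ) (p : ℝ) : ℝ :=
  b * p * Real.exp (-(b * p)) * ∑ i ∈ Finset.range κ, (b * p) ^ i / (Nat.factorial i : ℝ)

noncomputable def auxS (n : ℕ) (x : ℝ) : ℝ :=
  ∑ i ∈ Finset.range (n + 1), x ^ i / (Nat.factorial i : ℝ)

noncomputable def auxF (n : ℕ) (x : ℝ) : ℝ := x * Real.exp (-x) * auxS n x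

lemma auxS_deriv (n : ℕ) (x : ℝ) :
    HasDerivAt (auxS n) (auxS n x - x ^ n / (Nat.factorial n : ℝ)) x := by
  induction n with
  | zero =>
    have : auxS 0 = fun _ => (1 : ℝ) := by funext y; simp [auxS]
    rw [this]
    simpa using hasDerivAt_const x (1 : ℝ)
  | succ n ih =>
    have h : auxS (n + 1) = fun y => auxS n y + y ^ (n + 1) / (Nat.factorial (n + 1) : ℝ) := by
      funext y; simp only [auxS]; rw [Finset.sum_range_succ]
    rw [h]
    have h2 := ih.add ((hasDerivAt_pow (n + 1) x).div_const (Nat.factorial (n + 1) : ℝ))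
    refine h2.congr_deriv ?_
    have : (Nat.factorial n : ℝ) ≠ 0 := by positivity
    have : (n : ℝ) + 1 ≠ 0 := by positivity
    simp only [Nat.factorial_succ]
    push_cast
    field_simp
    ring

lemma auxF_deriv (n : ℕ) (x : ℝ) :
    HasDerivAt (auxF n) (Real.exp (-x) * (auxS n x - x ^ (n + 1) / (Nat.factorial n : ℝ))) x := by
  have h := (((hasDerivAt_id x).mul (hasDerivAt_id x).neg.exp)).mul (auxS_deriv n x)
  refine h.congr_deriv ?_
  simp only [id, Pi.mul_apply, Pi.neg_apply]
  ring

lemma auxS_key (n : ℕ) {x y : ℝ} (hx : 0 < x) (hxy : x < y) :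
    auxS n y * x ^ (n + 1) < auxS n x * y ^ (n + 1) := by
  unfold auxS
  rw [Finset.sum_mul, Finset.sum_mul]
  apply Finset.sum_lt_sum_of_nonempty (by simp)
  intro i hi
  have hi : i ≤ n := by simpa [Nat.lt_succ_iff] using hi
  obtain ⟨k, rfl⟩ := Nat.exists_eq_add_of_le hi
  have hy : 0 < y := hx.trans hxy
  have h1 : x ^ (k + 1) < y ^ (k + 1) := pow_lt_pow_left₀ hxy hx.le (by simp)
  have h2 : 0 < x ^ i * y ^ i / (Nat.factorial i : ℝ) := by positivity
  have := mul_lt_mul_of_pos_left h1 h2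
  calc _ = x ^ i * y ^ i / (Nat.factorial i : ℝ) * x ^ (k + 1) := by ring
    _ < _ := this
    _ = _ := by ring

lemma auxS_root (n : ℕ) : ∃ x : ℝ, 0 < x ∧ x ^ (n + 1) / (Nat.factorial n : ℝ) = auxS n x := by
  have hc : Continuous fun x => auxS n x - x ^ (n + 1) / (Nat.factorial n : ℝ) := by
    unfold auxS; fun_prop
  have hf : (1 : ℝ) ≤ (Nat.factorial n : ℝ) := by exact_mod_cast Nat.factorial_pos n
  set M : ℝ := (n + 1) * (Nat.factorial n : ℝ) with hM
  have hn : (0 : ℝ) ≤ n := by positivity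
  have hM1 : 1 ≤ M := by nlinarith
  have h0 : auxS n 0 = 1 := by
    unfold auxS; rw [Finset.sum_range_succ']; simp
  have hMle : auxS n M ≤ M ^ (n + 1) / (Nat.factorial n : ℝ) := by
    calc auxS n M ≤ ∑ i ∈ Finset.range (n + 1), M ^ n := by
          apply Finset.sum_le_sum
          intro i hi
          have hi : i ≤ n := by simpa [Nat.lt_succ_iff] using hi
          have h1 : (1 : ℝ) ≤ (Nat.factorial i : ℝ) := by exact_mod_cast Nat.factorial_pos i
          exact (div_le_self (by positivity) h1).trans (pow_le_pow_right₀ hM1 hi)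
      _ = M ^ n * (n + 1) := by simp; ring
      _ = M ^ (n + 1) / (Nat.factorial n : ℝ) := by
          rw [pow_succ, eq_div_iff (by positivity), hM]; ring
  obtain ⟨x, hx, hx0⟩ := intermediate_value_Icc' (by linarith : (0 : ℝ) ≤ M) hc.continuousOn
    (show (0 : ℝ) ∈ Set.Icc _ _ from ⟨by simpa using hMle, by simp [h0]⟩)
  refine ⟨x, lt_of_le_of_ne hx.1 ?_, by simp only at hx0; linarith⟩
  rintro rfl
  simp [h0] at hx0

lemma auxD_neg (n : ℕ) {x y : ℝ} (hx : 0 < x) (hxy : x < y)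
    (h : auxS n x ≤ x ^ (n + 1) / (Nat.factorial n : ℝ)) :
    auxS n y < y ^ (n + 1) / (Nat.factorial n : ℝ) := by
  have hy : 0 < y := hx.trans hxy
  have h1 := auxS_key n hx hxy
  have h2 := mul_le_mul_of_nonneg_right h (by positivity : 0 ≤ y ^ (n + 1))
  have h3 : auxS n y * x ^ (n + 1) < y ^ (n + 1) / (Nat.factorial n : ℝ) * x ^ (n + 1) := by
    calc _ < _ := h1
      _ ≤ _ := h2
      _ = _ := by ring
  exact lt_of_mul_lt_mul_right h3 (by positivity)

/-- There is exactly one `p_* ∈ (0,∞)` maximizing `p ↦ s_IB(p,κ)`; it is characterised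
as the unique positive solution of `(bp)^κ/(κ−1)! = Σ_{i=0}^{κ−1} (bp)^i/i!`, and
`s_IB(·,κ)` is strictly increasing on `(0,p_*]` and strictly decreasing on `[p_*,∞)`. -/
theorem sIB_unique_maximizer (b : ℝ) (hb : 0 < b) (κ : ℕ) (hκ : 0 < κ) :
    ∃ pstar : ℝ, 0 < pstar ∧
      (∀ q : ℝ, 0 < q →
        ((b * q) ^ κ / (Nat.factorial (κ - 1) : ℝ)
            = ∑ i ∈ Finset.range κ, (b * q) ^ i / (Nat.factorial i : ℝ) ↔ q = pstar)) ∧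
      (∀ q : ℝ, 0 < q → q ≠ pstar → sIB b κ q < sIB b κ pstar) ∧
      StrictMonoOn (sIB b κ) (Set.Ioc 0 pstar) ∧
      StrictAntiOn (sIB b κ) (Set.Ici pstar) := by

  obtain ⟨n, rfl⟩ : ∃ n, κ = n + 1 := ⟨κ - 1, by omega⟩
  obtain ⟨x₀, hx₀, hr⟩ := auxS_root n
  have hs : sIB b (n + 1) = fun p => auxF n (b * p) := rfl
  have hcont : Continuous (auxF n) :=
    continuous_iff_continuousAt.2 fun x => (auxF_deriv n x).continuousAt
  have hmono : StrictMonoOn (auxF n) (Set.Icc 0 x₀) := by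
    apply strictMonoOn_of_deriv_pos (convex_Icc _ _) hcont.continuousOn
    intro x hx
    rw [interior_Icc] at hx
    rw [(auxF_deriv n x).deriv]
    apply mul_pos (Real.exp_pos _)
    by_contra hcon
    have := auxD_neg n hx.1 hx.2 (by linarith)
    linarith
  have hanti : StrictAntiOn (auxF n) (Set.Ici x₀) := by
    apply strictAntiOn_of_deriv_neg (convex_Ici _) hcont.continuousOn
    intro x hx
    rw [interior_Ici] at hx
    rw [(auxF_deriv n x).deriv]
    apply mul_neg_of_pos_of_neg (Real.exp_pos _)
    have := auxD_neg n hx₀ hx hr.ge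
    linarith
  have hbx : b * (x₀ / b) = x₀ := by field_simp
  have hle : ∀ q, q ≤ x₀ / b → b * q ≤ x₀ := fun q hq => by
    have := mul_le_mul_of_nonneg_left hq hb.le
    rwa [hbx] at this
  have hge : ∀ q, x₀ / b ≤ q → x₀ ≤ b * q := fun q hq => by
    have := mul_le_mul_of_nonneg_left hq hb.le
    rwa [hbx] at this
  have hM : StrictMonoOn (sIB b (n + 1)) (Set.Ioc 0 (x₀ / b)) := by
    intro p hp q hq hpq
    rw [hs]
    exact hmono ⟨(mul_pos hb hp.1).le, hle p hp.2⟩ ⟨(mul_pos hb hq.1).le, hle q hq.2⟩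
      (mul_lt_mul_of_pos_left hpq hb)
  have hA : StrictAntiOn (sIB b (n + 1)) (Set.Ici (x₀ / b)) := by
    intro p hp q hq hpq
    rw [hs]
    exact hanti (hge p hp) (hge q hq) (mul_lt_mul_of_pos_left hpq hb)
  have hp0 : 0 < x₀ / b := by positivity
  refine ⟨x₀ / b, hp0, ?_, ?_, hM, hA⟩
  · intro q hq
    change (b * q) ^ (n + 1) / (Nat.factorial n : ℝ) = auxS n (b * q) ↔ _
    constructor
    · intro h
      rw [eq_div_iff hb.ne', mul_comm]
      rcases lt_trichotomy (b * q) x₀ with hlt | heq | hgt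
      · have := auxD_neg n (mul_pos hb hq) hlt h.ge
        linarith
      · exact heq
      · have := auxD_neg n hx₀ hgt hr.ge
        linarith
    · rintro rfl
      rw [hbx]; exact hr
  · intro q hq hne
    rcases lt_or_gt_of_ne hne with hlt | hgt
    · exact hM ⟨hq, hlt.le⟩ ⟨hp0, le_rfl⟩ hlt
    · exact hA Set.self_mem_Ici hgt.le hgt
end

section
/- Fix an integer κ≥1 and let a_* be the unique positive real number satisfying a_*^κ/(κ−1)! = Σ_{i=0}^{κ−1} a_*^i/i!. Then for every integer i with 0 ≤ i ≤ κ−1, one has a_* ≥ (i+1)^{1−1/(κ−i)}. -/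
open scoped BigOperators

/-- Any positive solution `a` of `a^κ/(κ−1)! = Σ_{i=0}^{κ−1} a^i/i!` (for `κ ≥ 1`)
satisfies `a ≥ (i+1)^{1−1/(κ−i)}` for every `0 ≤ i ≤ κ−1`. -/
theorem optimal_attempt_rate_lower_bound (κ : ℕ) (hκ : 1 ≤ κ) (a : ℝ) (ha : 0 < a)
    (heq : a ^ κ / (Nat.factorial (κ - 1) : ℝ)
      = ∑ i ∈ Finset.range κ, a ^ i / (Nat.factorial i : ℝ)) :
    ∀ i : ℕ, i < κ → ((i : ℝ) + 1) ^ (1 - 1 / ((κ : ℝ) - (i : ℝ))) ≤ a := by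
  intro i hi
  obtain ⟨m, rfl⟩ : ∃ m, κ = i + m + 1 := ⟨κ - i - 1, by omega⟩
  have h1 : a ^ i / (Nat.factorial i : ℝ) ≤ a ^ (i + m + 1) / (Nat.factorial (i + m) : ℝ) := by
    have h := Finset.single_le_sum (f := fun i : ℕ => a ^ i / (Nat.factorial i : ℝ))
      (fun j _ => by positivity) (Finset.mem_range.mpr hi)
    rw [← heq] at h
    simpa using h
  have h2 : (Nat.factorial i : ℝ) * ((i : ℝ) + 1) ^ m ≤ (Nat.factorial (i + m) : ℝ) := by
    exact_mod_cast Nat.factorial_mul_pow_le_factorial (m := i) (n := m)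
  have hf : (0 : ℝ) < (Nat.factorial i : ℝ) := by positivity
  have hg : (0 : ℝ) < (Nat.factorial (i + m) : ℝ) := by positivity
  have h3 : ((i : ℝ) + 1) ^ m ≤ a ^ (m + 1) := by
    rw [div_le_div_iff₀ hf hg] at h1
    have hp : 0 < a ^ i * (Nat.factorial i : ℝ) := by positivity
    refine le_of_mul_le_mul_left ?_ hp
    calc a ^ i * (Nat.factorial i : ℝ) * ((i : ℝ) + 1) ^ m
        = a ^ i * ((Nat.factorial i : ℝ) * ((i : ℝ) + 1) ^ m) := by ring
      _ ≤ a ^ i * (Nat.factorial (i + m) : ℝ) := by gcongr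
      _ ≤ a ^ (i + m + 1) * (Nat.factorial i : ℝ) := h1
      _ = a ^ i * (Nat.factorial i : ℝ) * a ^ (m + 1) := by ring
  refine le_of_pow_le_pow_left₀ (Nat.succ_ne_zero m) ha.le ?_
  refine le_trans (le_of_eq ?_) h3
  rw [← Real.rpow_natCast, ← Real.rpow_mul (by positivity), ← Real.rpow_natCast]
  congr 1
  have : (m : ℝ) + 1 ≠ 0 := by positivity
  have e : ((i + m + 1 : ℕ) : ℝ) - (i : ℝ) = (m : ℝ) + 1 := by push_cast; ring
  rw [e]
  push_cast
  field_simp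
  ring
end

section
/- For each integer κ≥1 let a_*(κ) be the unique positive real number satisfying a_*(κ)^κ/(κ−1)! = Σ_{i=0}^{κ−1} a_*(κ)^i/i!. Then a_*(κ)/κ → 1 as κ → ∞. -/
open scoped BigOperators

lemma aux_upper (n : ℕ) (hn : 1 ≤ n) (x : ℝ) (hx : 0 < x)
    (h : x ^ n / (Nat.factorial (n - 1) : ℝ)
        = ∑ i ∈ Finset.range n, x ^ i / (Nat.factorial i : ℝ)) : x ≤ n := by
  by_contra! hlt
  obtain ⟨k, rfl⟩ : ∃ k, n = k + 1 := ⟨n - 1, by omega⟩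
  simp only [Nat.add_sub_cancel] at h
  have step : ∀ j, j ≤ k → x ^ (k - j) / (Nat.factorial (k - j) : ℝ) ≤ x ^ k / (Nat.factorial k : ℝ) := by
    intro j
    induction j with
    | zero => intro _; simp
    | succ j ih =>
      intro hj
      refine le_trans ?_ (ih (by omega))
      obtain ⟨i, hi⟩ : ∃ i, k - j = i + 1 := ⟨k - j - 1, by omega⟩
      have hi2 : k - (j + 1) = i := by omega
      rw [hi, hi2, Nat.factorial_succ, pow_succ]
      have hf : (0 : ℝ) < (Nat.factorial i : ℝ) := by positivity
      rw [div_le_div_iff₀ hf (by positivity)]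
      have hik : ((i + 1 : ℕ) : ℝ) ≤ x := by
        refine le_trans ?_ hlt.le
        exact_mod_cast (by omega : i + 1 ≤ k + 1)
      push_cast at hik ⊢
      have hp : 0 ≤ x ^ i * (Nat.factorial i : ℝ) := by positivity
      nlinarith [mul_le_mul_of_nonneg_left hik hp]
  have hs : ∑ i ∈ Finset.range (k + 1), x ^ i / (Nat.factorial i : ℝ)
      ≤ ∑ i ∈ Finset.range (k + 1), x ^ k / (Nat.factorial k : ℝ) := by
    apply Finset.sum_le_sum
    intro i hi
    have hi' : i < k + 1 := Finset.mem_range.mp hi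
    have := step (k - i) (by omega)
    rwa [show k - (k - i) = i by omega] at this
  rw [← h, Finset.sum_const, Finset.card_range, nsmul_eq_mul, pow_succ] at hs
  have hp : 0 < x ^ k / (Nat.factorial k : ℝ) := by positivity
  have e : x ^ k * x / (Nat.factorial k : ℝ) = x * (x ^ k / (Nat.factorial k : ℝ)) := by ring
  rw [e] at hs
  exact absurd (le_of_mul_le_mul_right hs hp) (not_le.mpr hlt)

lemma aux_lower_s9 (n m : ℕ) (hm : m < n) (x : ℝ) (hx : 0 < x)
    (h : x ^ n / (Nat.factorial (n - 1) : ℝ)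
        = ∑ i ∈ Finset.range n, x ^ i / (Nat.factorial i : ℝ)) :
    ((n : ℝ) - m) ^ m ≤ x ^ m * x := by
  have h1 : x ^ (n - 1 - m) / (Nat.factorial (n - 1 - m) : ℝ) ≤ x ^ n / (Nat.factorial (n - 1) : ℝ) := by
    rw [h]
    exact Finset.single_le_sum (f := fun i => x ^ i / (Nat.factorial i : ℝ))
      (fun i _ => by positivity) (Finset.mem_range.mpr (by omega))
  have h2 := Nat.factorial_mul_descFactorial (show m ≤ n - 1 by omega)
  have h3 := Nat.pow_sub_le_descFactorial (n - 1) m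
  rw [show n - 1 + 1 - m = n - m by omega] at h3
  have h3' : ((n : ℝ) - m) ^ m ≤ ((n - 1).descFactorial m : ℝ) := by
    rw [← Nat.cast_sub hm.le]; exact_mod_cast h3
  refine h3'.trans ?_
  rw [← h2] at h1
  have hf : (0 : ℝ) < (Nat.factorial (n - 1 - m) : ℝ) := by positivity
  have hd : (0 : ℝ) < ((n - 1).descFactorial m : ℝ) := by
    exact_mod_cast Nat.descFactorial_pos.mpr (by omega)
  push_cast at h1
  rw [div_le_div_iff₀ hf (by positivity)] at h1
  have e : x ^ n = x ^ (n - 1 - m) * (x ^ m * x) := by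
    rw [← pow_succ, ← pow_add]; congr 1; omega
  rw [e] at h1
  have hp : 0 < x ^ (n - 1 - m) * (Nat.factorial (n - 1 - m) : ℝ) := by positivity
  refine le_of_mul_le_mul_left ?_ hp
  linarith

/-- If `a(κ)` is, for each `κ ≥ 1`, the positive solution of
`a^κ/(κ−1)! = Σ_{i=0}^{κ−1} a^i/i!`, then `a(κ)/κ → 1` as `κ → ∞`. -/
theorem optimal_attempt_rate_asymptotics (a : ℕ → ℝ)
    (ha : ∀ κ : ℕ, 1 ≤ κ → 0 < a κ ∧
      (a κ) ^ κ / (Nat.factorial (κ - 1) : ℝ)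
        = ∑ i ∈ Finset.range κ, (a κ) ^ i / (Nat.factorial i : ℝ)) :
    Filter.Tendsto (fun κ : ℕ => a κ / (κ : ℝ)) Filter.atTop (nhds 1) := by
  rw [tendsto_order]
  constructor
  · intro c' hc'
    obtain ⟨c, hcm, hc1⟩ := exists_between (max_lt hc' (zero_lt_one : (0 : ℝ) < 1))
    have hc0 : 0 < c := lt_of_le_of_lt (le_max_right _ _) hcm
    have hcc : c' < c := lt_of_le_of_lt (le_max_left _ _) hcm
    obtain ⟨d, hcd, hd1⟩ := exists_between hc1
    obtain ⟨K, hK⟩ := exists_nat_gt (1 / (1 - d))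
    have hd : 0 < 1 - d := by linarith
    have hKr : (0 : ℝ) < K := lt_trans (by positivity) hK
    have hK0 : 0 < K := by exact_mod_cast hKr
    have hK1 : 1 < K * (1 - d) := by rwa [div_lt_iff₀ hd] at hK
    have hr : 1 < d / c := by rwa [one_lt_div hc0]
    have hev := (tendsto_pow_const_div_const_pow_of_one_lt 1 hr).eventually
      (gt_mem_nhds (show (0 : ℝ) < 1 / (2 * K) by positivity))
    have hdiv : Filter.Tendsto (fun n : ℕ => n / K) Filter.atTop Filter.atTop :=
      Nat.tendsto_div_const_atTop hK0.ne'
    filter_upwards [hdiv.eventually hev, hdiv.eventually (Filter.eventually_ge_atTop 1),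
      Filter.eventually_ge_atTop 1] with n h1 h2 hn
    obtain ⟨hx, h⟩ := ha n hn
    have hn0 : (0 : ℝ) < n := by exact_mod_cast hn
    refine lt_trans hcc ?_
    rw [lt_div_iff₀ hn0]
    by_contra! hle
    have hmK : n / K * K ≤ n := Nat.div_mul_le_self n K
    have hnK : n < (n / K + 1) * K := by
      have := Nat.lt_mul_div_succ n hK0
      rwa [mul_comm] at this
    generalize n / K = m at *
    have hmK' : (m : ℝ) * K ≤ n := by exact_mod_cast hmK
    have hnK' : (n : ℝ) < (m + 1) * K := by exact_mod_cast hnK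
    have h2' : (1 : ℝ) ≤ m := by exact_mod_cast h2
    have hmd : (m : ℝ) ≤ (1 - d) * n := by nlinarith
    have hmn : m < n := by
      have : (m : ℝ) < n := by nlinarith
      exact_mod_cast this
    have key := aux_lower_s9 n m hmn (a n) hx h
    have hd0 : 0 < d := hc0.trans hcd
    have k1 : (d * n) ^ m ≤ ((n : ℝ) - m) ^ m := by
      apply pow_le_pow_left₀ (by positivity); linarith
    have k2 : a n ^ m * a n ≤ (c * n) ^ m * n := by
      apply mul_le_mul (pow_le_pow_left₀ hx.le hle m) (by nlinarith) hx.le (by positivity)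
    have k3 : (d * n) ^ m = (c * n) ^ m * (d / c) ^ m := by
      rw [← mul_pow]; congr 1; field_simp
    have k4 : (d / c) ^ m ≤ n := by
      refine le_of_mul_le_mul_left ?_ (show 0 < (c * n) ^ m by positivity)
      linarith
    rw [pow_one, div_lt_div_iff₀ (by positivity) (by positivity)] at h1
    nlinarith
  · intro c hc
    filter_upwards [Filter.eventually_ge_atTop 1] with n hn
    have hn0 : (0 : ℝ) < n := by exact_mod_cast hn
    refine lt_of_le_of_lt ?_ hc
    rw [div_le_one hn0]
    exact aux_upper n hn (a n) (ha n hn).1 (ha n hn).2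
end

section
/- Let κ∈ℕ, let w_0,…,w_κ be strictly positive real numbers, and let a∈(0,κ) satisfy Σ_{k=0}^κ k·w_k·(k−a) = 0. Then for every real C ≠ 0, Σ_{k=0}^κ w_k·(e^{Ck}−1)·(k−a) > 0. -/
open scoped BigOperators

theorem aux_secant (C : ℝ) (hC : C ≠ 0) (x y : ℝ) (hx : 0 < x) (hxy : x < y) :
    (Real.exp (C * x) - 1) / x < (Real.exp (C * y) - 1) / y := by
  have hy : 0 < y := hx.trans hxy
  have key : ∀ u v : ℝ, u ≠ 0 → v ≠ 0 → u < v →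
      (Real.exp u - 1) / u < (Real.exp v - 1) / v := by
    intro u v hu hv huv
    have h := strictConvexOn_exp.secant_strict_mono (Set.mem_univ (0:ℝ)) (Set.mem_univ u)
      (Set.mem_univ v) hu hv huv
    simpa using h
  have e : ∀ z : ℝ, 0 < z → (Real.exp (C * z) - 1) / z = C * ((Real.exp (C * z) - 1) / (C * z)) := by
    intro z hz
    field_simp
  rw [e x hx, e y hy]
  have h1 : C * x ≠ 0 := mul_ne_zero hC hx.ne'
  have h2 : C * y ≠ 0 := mul_ne_zero hC hy.ne'
  rcases lt_or_gt_of_ne hC with h | h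
  · exact mul_lt_mul_of_neg_left (key _ _ h2 h1 (mul_lt_mul_of_neg_left hxy h)) h
  · exact mul_lt_mul_of_pos_left (key _ _ h1 h2 (mul_lt_mul_of_pos_left hxy h)) h

theorem aux_term (C : ℝ) (hC : C ≠ 0) (a : ℝ) (ha : 0 < a) (x : ℝ) (hx : 0 < x) (hxa : x ≠ a) :
    0 < (Real.exp (C * x) - 1 - x * ((Real.exp (C * a) - 1) / a)) * (x - a) := by
  have e : Real.exp (C * x) - 1 - x * ((Real.exp (C * a) - 1) / a)
      = x * ((Real.exp (C * x) - 1) / x - (Real.exp (C * a) - 1) / a) := by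
    field_simp
  rw [e]
  rcases lt_or_gt_of_ne hxa with h | h
  · have := aux_secant C hC x a hx h
    exact mul_pos_of_neg_of_neg (mul_neg_of_pos_of_neg hx (by linarith)) (by linarith)
  · have := aux_secant C hC a x ha h
    exact mul_pos (mul_pos hx (by linarith)) (by linarith)

/-- If `w_0,…,w_κ > 0`, `a ∈ (0,κ)` and `Σ_{k=0}^κ k·w_k·(k−a) = 0`, then for every
`C ≠ 0` one has `Σ_{k=0}^κ w_k·(e^{Ck}−1)·(k−a) > 0`. -/
theorem exp_weighted_sum_pos (κ : ℕ) (hκ : 0 < κ) (w : ℕ → ℝ)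
    (hw : ∀ k, k ≤ κ → 0 < w k) (a : ℝ) (ha : a ∈ Set.Ioo 0 (κ : ℝ))
    (hsum : ∑ k ∈ Finset.range (κ + 1), (k : ℝ) * w k * ((k : ℝ) - a) = 0) :
    ∀ C : ℝ, C ≠ 0 →
      0 < ∑ k ∈ Finset.range (κ + 1), w k * (Real.exp (C * k) - 1) * ((k : ℝ) - a) := by
  intro C hC
  obtain ⟨ha0, haκ⟩ := ha
  have e : ∑ k ∈ Finset.range (κ + 1), w k * (Real.exp (C * k) - 1) * ((k : ℝ) - a)
      = ∑ k ∈ Finset.range (κ + 1),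
        w k * ((Real.exp (C * k) - 1 - k * ((Real.exp (C * a) - 1) / a)) * ((k : ℝ) - a)) := by
    rw [← sub_eq_zero, ← Finset.sum_sub_distrib,
      ← mul_zero ((Real.exp (C * a) - 1) / a), ← hsum, Finset.mul_sum]
    refine Finset.sum_congr rfl fun k _ => ?_
    ring
  rw [e]
  refine Finset.sum_pos' (fun k hk => ?_) ⟨κ, by simp, ?_⟩
  · refine mul_nonneg (hw k (by simpa [Nat.lt_succ_iff] using hk)).le ?_
    rcases Nat.eq_zero_or_pos k with rfl | h0
    · simp
    · by_cases h : (k : ℝ) = a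
      · simp [h]
      · exact (aux_term C hC a ha0 k (by exact_mod_cast h0) h).le
  · exact mul_pos (hw κ le_rfl) (aux_term C hC a ha0 κ (by exact_mod_cast hκ) haκ.ne')
end

section
/- Let λ>0 and κ∈ℕ. Then Σ_{k=0}^κ k²·e^{−λ}λ^k/k! − λ·Σ_{k=0}^κ k·e^{−λ}λ^k/k! = λ·e^{−λ}·( Σ_{i=0}^{κ−1} λ^i/i! − λ^κ/(κ−1)! ). -/
open scoped BigOperators

/-- The identity `Σ_{k=0}^κ k²·Poi_λ(k) − λ·Σ_{k=0}^κ k·Poi_λ(k)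
= λ·e^{−λ}·(Σ_{i=0}^{κ−1} λ^i/i! − λ^κ/(κ−1)!)`. -/
theorem poisson_truncated_second_moment_identity (lam : ℝ) (hlam : 0 < lam)
    (κ : ℕ) (hκ : 0 < κ) :
    ∑ k ∈ Finset.range (κ + 1), (k : ℝ) ^ 2 * Real.exp (-lam) * lam ^ k / (Nat.factorial k : ℝ)
      - lam * ∑ k ∈ Finset.range (κ + 1), (k : ℝ) * Real.exp (-lam) * lam ^ k / (Nat.factorial k : ℝ)
    = lam * Real.exp (-lam) *
        (∑ i ∈ Finset.range κ, lam ^ i / (Nat.factorial i : ℝ)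
          - lam ^ κ / (Nat.factorial (κ - 1) : ℝ)) := by
  obtain ⟨n, rfl⟩ : ∃ n, κ = n + 1 := ⟨κ - 1, by omega⟩
  clear hκ
  induction n with
  | zero => simp [Finset.sum_range_succ]; ring
  | succ n ih =>
    rw [Finset.sum_range_succ, Finset.sum_range_succ _ (n + 1 + 1),
      Finset.sum_range_succ (fun i => lam ^ i / (Nat.factorial i : ℝ)) (n + 1)]
    rw [Nat.add_sub_cancel] at ih ⊢
    have hf : (Nat.factorial n : ℝ) ≠ 0 := by positivity
    have hn : (n : ℝ) + 1 ≠ 0 := by positivity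
    have hn2 : (n : ℝ) + 1 + 1 ≠ 0 := by positivity
    have key : ((n + 1 + 1 : ℕ) : ℝ) ^ 2 * Real.exp (-lam) * lam ^ (n + 1 + 1) /
          (Nat.factorial (n + 1 + 1) : ℝ)
        - lam * (((n + 1 + 1 : ℕ) : ℝ) * Real.exp (-lam) * lam ^ (n + 1 + 1) /
          (Nat.factorial (n + 1 + 1) : ℝ))
        = lam * Real.exp (-lam) * (lam ^ (n + 1) / (Nat.factorial (n + 1) : ℝ)
          - lam ^ (n + 1 + 1) / (Nat.factorial (n + 1) : ℝ)
          + lam ^ (n + 1) / (Nat.factorial n : ℝ)) := by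
      rw [Nat.factorial_succ (n + 1), Nat.factorial_succ n]
      push_cast
      field_simp
      ring
    linear_combination ih + key
end
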